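/- For every f in the class 𝓕, there exists a homogeneously multifractal (HM) Borel probability measure μ supported in [0,1] such that: (1) for all h ∈ Support*(f) \ {1}, d_μ(h) = max(f(h), 0); (2) d_μ(h) = −∞ for all h ∈ [0,∞) \ Support*(f); (3) the set {x ∈ [0,1] : h_μ(x) = 1} has Lebesgue measure 1. In particular, Support(d_μ) = Support*(f). -/

import Mathlib

open MeasureTheory Metric Filter Set
open scoped ENNReal Topology
open Classical

/-- The lower local dimension (local Hölder exponent) of a measure `μ` on `ℝ` at `x`:
`liminf_{r → 0⁺} log μ(B(x,r)) / log r`, with the convention that it is `+∞`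
when `x` does not belong to the support of `μ`. -/
noncomputable def locDim (μ : Measure ℝ) (x : ℝ) : EReal :=
  if ∀ r : ℝ, 0 < r → 0 < μ (ball x r) then
    Filter.liminf
      (fun r : ℝ => ((Real.log ((μ (ball x r)).toReal) / Real.log r : ℝ) : EReal))
      (nhdsWithin 0 (Set.Ioi 0))
  else ⊤

/-- Hausdorff dimension of a set, with the convention `dim ∅ = -∞`. -/
noncomputable def dimHE (s : Set ℝ) : EReal :=
  if s.Nonempty then ((dimH s : ℝ≥0∞) : EReal) else ⊥

/-- The multifractal spectrum of a measure supported in `[0,1]`: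
`d_μ(h) = dim_H {x ∈ [0,1] : h_μ(x) = h}`, with `dim ∅ = -∞`. -/
noncomputable def spec (μ : Measure ℝ) (h : EReal) : EReal :=
  dimHE {x ∈ Set.Icc (0:ℝ) 1 | locDim μ x = h}

/-- A measure supported in `[0,1]` is homogeneously multifractal (HM) if its restriction to any
non-degenerate subinterval of `[0,1]` has the same multifractal spectrum as the whole measure. -/
def IsHM (μ : Measure ℝ) : Prop :=
  ∀ a b : ℝ, 0 ≤ a → a < b → b ≤ 1 →
    ∀ h : EReal, 0 ≤ h →
      dimHE {x ∈ Set.Ioo a b | locDim μ x = h} = spec μ h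

/-- The class `𝓕` of admissible spectra: suprema of countably many step functions `f_n`,
each supported by a closed subinterval `Iₙ ⊆ [0,1]`, bounded away from `0` uniformly,
constant (with value `vₙ ∈ [0,1]`) on `Iₙ`, with `fₙ(x) ≤ x` on `Iₙ`, and `f = sup_n fₙ`. -/
def MemF (f : ℝ → EReal) : Prop :=
  ∃ (I : ℕ → Set ℝ) (v : ℕ → EReal),
    (∀ n, ∃ a b : ℝ, a ≤ b ∧ I n = Set.Icc a b) ∧
    (∀ n, I n ⊆ Set.Icc (0:ℝ) 1) ∧
    (∃ c : ℝ, 0 < c ∧ ∀ n, ∀ x ∈ I n, c ≤ x) ∧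
    (∀ n, 0 ≤ v n ∧ v n ≤ 1) ∧
    (∀ n, ∀ x ∈ I n, v n ≤ (x : EReal)) ∧
    (∀ x : ℝ, f x = ⨆ n, (if x ∈ I n then v n else ⊥))

/-- The integer `d₁ + 2 d₂` attached to a digit `(d₁, d₂)`. -/
def digitVal {N : ℕ} (d : Fin 2 × Fin N) : ℕ := d.1 + 2 * d.2

lemma digitVal_lt {N : ℕ} (d : Fin 2 × Fin N) : digitVal d < 2 * N := by
  have := d.1.2; have := d.2.2; unfold digitVal; omega

lemma digitVal_injective {N : ℕ} : Function.Injective (digitVal (N := N)) := by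
  rintro ⟨a, b⟩ ⟨c, d⟩ h
  simp only [digitVal] at h
  ext <;> simp <;> omega

/-- The point `∑ d_k l ^ k` of the self-similar set of ratio `l` with digits in `{0, …, 2 * N - 1}`. -/
noncomputable def cantorMap {N : ℕ} (l : ℝ) (x : ℕ → Fin 2 × Fin N) : ℝ :=
  ∑' k, (digitVal (x k) : ℝ) * l ^ k

/-- An upper bound for the self-similar set of ratio `l`. -/
noncomputable def cantorBound (N : ℕ) (l : ℝ) : ℝ := (2 * N - 1) / (1 - l)

/-- A lower bound for the distance between the first level pieces. -/
noncomputable def cantorGap (N : ℕ) (l : ℝ) : ℝ := 1 - l * cantorBound N l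

section Cantor

variable {N : ℕ} {l : ℝ}

lemma ratio_lt_one (hN : 1 ≤ N) (hNl : 2 * N * l < 1) : l < 1 := by
  have : (1 : ℝ) ≤ N := by exact_mod_cast hN
  nlinarith

lemma cantorGap_pos (hN : 1 ≤ N) (hNl : 2 * N * l < 1) : 0 < cantorGap N l := by
  have h1 := ratio_lt_one hN hNl
  unfold cantorGap cantorBound
  have : l * ((2 * N - 1) / (1 - l)) < 1 := by
    rw [← mul_div_assoc, div_lt_one (by linarith)]; nlinarith
  linarith

lemma cantorBound_nonneg (hN : 1 ≤ N) (hl : 0 < l) (hNl : 2 * N * l < 1) :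
    0 ≤ cantorBound N l := by
  have h1 := ratio_lt_one hN hNl
  have : (1 : ℝ) ≤ N := by exact_mod_cast hN
  unfold cantorBound
  apply div_nonneg <;> linarith

lemma digit_term_le (hl : 0 < l) (x : ℕ → Fin 2 × Fin N) (k : ℕ) :
    (digitVal (x k) : ℝ) * l ^ k ≤ (2 * N - 1) * l ^ k := by
  have h := digitVal_lt (x k)
  have : (digitVal (x k) : ℝ) + 1 ≤ 2 * N := by exact_mod_cast h
  gcongr
  linarith

lemma summable_cantor (hl : 0 < l) (hl1 : l < 1) (x : ℕ → Fin 2 × Fin N) :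
    Summable fun k => (digitVal (x k) : ℝ) * l ^ k :=
  Summable.of_nonneg_of_le (fun k => by positivity) (digit_term_le hl x)
    ((summable_geometric_of_lt_one hl.le hl1).mul_left _)

lemma cantorMap_nonneg (hl : 0 < l) (x : ℕ → Fin 2 × Fin N) : 0 ≤ cantorMap l x :=
  tsum_nonneg fun k => by positivity

lemma cantorMap_le (hl : 0 < l) (hl1 : l < 1) (x : ℕ → Fin 2 × Fin N) :
    cantorMap l x ≤ cantorBound N l := by
  have := (summable_cantor hl hl1 x).tsum_le_tsum (digit_term_le hl x)
    ((summable_geometric_of_lt_one hl.le hl1).mul_left _)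
  rwa [tsum_mul_left, tsum_geometric_of_lt_one hl.le hl1, ← div_eq_mul_inv] at this

lemma cantorMap_eq (hl : 0 < l) (hl1 : l < 1) (x : ℕ → Fin 2 × Fin N) :
    cantorMap l x = digitVal (x 0) + l * cantorMap l (fun k => x (k + 1)) := by
  unfold cantorMap
  rw [(summable_cantor hl hl1 x).tsum_eq_zero_add, ← tsum_mul_left]
  simp only [pow_zero, mul_one]
  congr 1
  exact tsum_congr fun k => by ring

lemma abs_cantorMap_sub_le_bound (hl : 0 < l) (hl1 : l < 1) (x y : ℕ → Fin 2 × Fin N) :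
    |cantorMap l x - cantorMap l y| ≤ cantorBound N l := by
  have h1 := cantorMap_nonneg hl x
  have h2 := cantorMap_nonneg hl y
  have h3 := cantorMap_le hl hl1 x
  have h4 := cantorMap_le hl hl1 y
  rw [abs_le]; constructor <;> linarith

lemma gap_le_abs_sub (hl : 0 < l) (hl1 : l < 1) {p q : ℕ} (h : p ≠ q)
    (x y : ℕ → Fin 2 × Fin N) :
    cantorGap N l ≤ |(p + l * cantorMap l x) - (q + l * cantorMap l y)| := by
  have h1 : (1 : ℝ) ≤ |(p : ℝ) - q| := by
    have : (1 : ℤ) ≤ |(p : ℤ) - q| := Int.one_le_abs (by omega)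
    exact_mod_cast this
  have h2 := abs_cantorMap_sub_le_bound hl hl1 x y
  have h3 : |l * (cantorMap l y - cantorMap l x)| ≤ l * cantorBound N l := by
    rw [abs_mul, abs_of_pos hl, abs_sub_comm]; gcongr
  have h4 := abs_sub_abs_le_abs_sub ((p : ℝ) - q) (l * (cantorMap l y - cantorMap l x))
  have h5 : (p : ℝ) - q - l * (cantorMap l y - cantorMap l x)
    = (p + l * cantorMap l x) - (q + l * cantorMap l y) := by ring
  rw [h5] at h4
  unfold cantorGap
  linarith

lemma cantorMap_sub_eq (hl : 0 < l) (hl1 : l < 1) (k : ℕ) :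
    ∀ {x y : ℕ → Fin 2 × Fin N}, (∀ i < k, x i = y i) →
    cantorMap l x - cantorMap l y
      = l ^ k * (cantorMap l (fun i => x (i + k)) - cantorMap l (fun i => y (i + k))) := by
  induction k with
  | zero => intro x y _; simp
  | succ k ih =>
    intro x y h
    rw [cantorMap_eq hl hl1 x, cantorMap_eq hl hl1 y, h 0 (by omega), add_sub_add_left_eq_sub,
      ← mul_sub, ih (fun i hi => h (i + 1) (by omega)), pow_succ']
    simp only [mul_assoc, add_assoc]

lemma abs_cantorMap_sub_le (hl : 0 < l) (hl1 : l < 1) {k : ℕ} {x y : ℕ → Fin 2 × Fin N}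
    (h : ∀ i < k, x i = y i) : |cantorMap l x - cantorMap l y| ≤ cantorBound N l * l ^ k := by
  rw [cantorMap_sub_eq hl hl1 k h, abs_mul, abs_of_pos (by positivity), mul_comm]
  gcongr
  exact abs_cantorMap_sub_le_bound hl hl1 _ _

lemma gap_mul_pow_le (hl : 0 < l) (hl1 : l < 1) {k : ℕ} {x y : ℕ → Fin 2 × Fin N}
    (h : ∀ i < k, x i = y i) (hk : x k ≠ y k) :
    cantorGap N l * l ^ k ≤ |cantorMap l x - cantorMap l y| := by
  rw [cantorMap_sub_eq hl hl1 k h, abs_mul, abs_of_pos (by positivity), mul_comm]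
  gcongr
  rw [cantorMap_eq hl hl1 (fun i => x (i + k)), cantorMap_eq hl hl1 (fun i => y (i + k))]
  apply gap_le_abs_sub hl hl1
  simpa using fun h => hk (digitVal_injective h)

lemma exists_first_diff {α : Type*} {x y : ℕ → α} (h : x ≠ y) :
    ∃ k, (∀ i < k, x i = y i) ∧ x k ≠ y k := by
  have h' : ∃ k, x k ≠ y k := Function.ne_iff.mp h
  exact ⟨Nat.find h', fun i hi => not_not.mp (Nat.find_min h' hi), Nat.find_spec h'⟩

lemma cantorMap_injective (hN : 1 ≤ N) (hl : 0 < l) (hNl : 2 * N * l < 1) :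
    Function.Injective (cantorMap (N := N) l) := by
  intro x y h
  by_contra hxy
  obtain ⟨k, h1, h2⟩ := exists_first_diff hxy
  have h3 := gap_mul_pow_le hl (ratio_lt_one hN hNl) h1 h2
  rw [h, sub_self, abs_zero] at h3
  have := cantorGap_pos hN hNl
  have : 0 < cantorGap N l * l ^ k := by positivity
  linarith

lemma continuous_cantorMap (hl : 0 < l) (hl1 : l < 1) :
    Continuous (cantorMap (N := N) l) := by
  refine continuous_tsum (u := fun k => (2 * N - 1) * l ^ k) ?_
    ((summable_geometric_of_lt_one hl.le hl1).mul_left _) fun k x => ?_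
  · intro k
    exact (continuous_of_discreteTopology (f := fun d : Fin 2 × Fin N => (digitVal d : ℝ) * l ^ k)).comp
      (continuous_apply k)
  · rw [Real.norm_of_nonneg (by positivity)]
    exact digit_term_le hl x k

lemma isClosedEmbedding_cantorMap (hN : 1 ≤ N) (hl : 0 < l) (hNl : 2 * N * l < 1) :
    Topology.IsClosedEmbedding (cantorMap (N := N) l) :=
  (continuous_cantorMap hl (ratio_lt_one hN hNl)).isClosedEmbedding
    (cantorMap_injective hN hl hNl)

end Cantor

/-- A Hölder comparison between two parametrised images bounds the Hausdorff dimension. -/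
lemma dimH_image_le_of_holder {α : Type*} {A : Set α} {p q : α → ℝ} {K r : ℝ} (hK : 0 ≤ K)
    (hr : 0 < r) (h : ∀ x ∈ A, ∀ y ∈ A, |q x - q y| ≤ K * |p x - p y| ^ r) :
    dimH (q '' A) ≤ dimH (p '' A) / ENNReal.ofReal r := by
  rcases A.eq_empty_or_nonempty with rfl | ⟨a0, ha0⟩
  · simp
  have : Nonempty α := ⟨a0⟩
  set g : ℝ → ℝ := fun z => q (Function.invFunOn p A z) with hg
  have hinv : ∀ x ∈ A, Function.invFunOn p A (p x) ∈ A ∧ p (Function.invFunOn p A (p x)) = p x :=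
    fun x hx => ⟨Function.invFunOn_mem ⟨x, hx, rfl⟩, Function.invFunOn_eq ⟨x, hx, rfl⟩⟩
  have hgq : ∀ x ∈ A, g (p x) = q x := by
    intro x hx
    have := h _ (hinv x hx).1 x hx
    rw [(hinv x hx).2, sub_self, abs_zero, Real.zero_rpow hr.ne', mul_zero] at this
    exact sub_eq_zero.mp (abs_nonpos_iff.mp this)
  have hH : HolderOnWith K.toNNReal r.toNNReal g (p '' A) := by
    rintro _ ⟨x, hx, rfl⟩ _ ⟨y, hy, rfl⟩
    rw [hgq x hx, hgq y hy, edist_dist, edist_dist, Real.dist_eq, Real.dist_eq,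
      Real.coe_toNNReal _ hr.le, ENNReal.ofReal_rpow_of_nonneg (abs_nonneg _) hr.le]
    change _ ≤ ENNReal.ofReal K * _
    rw [← ENNReal.ofReal_mul hK]
    exact ENNReal.ofReal_le_ofReal (h x hx y hy)
  have := hH.dimH_image_le (Real.toNNReal_pos.mpr hr)
  rw [image_image] at this
  rwa [image_congr hgq] at this

lemma dimH_range_cantorMap_le {N : ℕ} {l v : ℝ} (hN : 1 ≤ N) (hl : 0 < l) (hNl : 2 * N * l < 1)
    (hv : 0 < v) (hNv : 2 * N * l ^ v < 1) :
    dimH (range (cantorMap (N := N) l)) ≤ ENNReal.ofReal v := by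
  have hl1 := ratio_lt_one hN hNl
  have hlv : 0 < l ^ v := by positivity
  have hlv1 := ratio_lt_one hN hNv
  have hg := cantorGap_pos hN hNv
  have hB := cantorBound_nonneg hN hl hNl
  have key := dimH_image_le_of_holder (A := univ) (p := cantorMap (N := N) (l ^ v))
    (q := cantorMap (N := N) l) (K := cantorBound N l / cantorGap N (l ^ v) ^ v⁻¹)
    (by positivity) (inv_pos.mpr hv) (by
      intro x _ y _
      by_cases hxy : x = y
      · subst hxy; simp; positivity
      obtain ⟨k, h1, h2⟩ := exists_first_diff hxy
      have h3 := abs_cantorMap_sub_le hl hl1 h1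
      have h4 := gap_mul_pow_le hlv hlv1 h1 h2
      have h5 := Real.rpow_le_rpow (by positivity) h4 (inv_pos.mpr hv).le
      rw [Real.mul_rpow hg.le (by positivity), ← Real.rpow_natCast (l ^ v), ← Real.rpow_mul hl.le,
        ← Real.rpow_mul hl.le, mul_comm v, mul_assoc, mul_inv_cancel₀ hv.ne', mul_one,
        Real.rpow_natCast] at h5
      calc _ ≤ cantorBound N l * l ^ k := h3
        _ = cantorBound N l / cantorGap N (l ^ v) ^ v⁻¹ * (cantorGap N (l ^ v) ^ v⁻¹ * l ^ k) := by
          field_simp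
        _ ≤ _ := by gcongr)
  rw [image_univ] at key
  refine key.trans ?_
  rw [ENNReal.div_eq_inv_mul, ← ENNReal.ofReal_inv_of_pos (inv_pos.mpr hv), inv_inv]
  have h1 : dimH (cantorMap (N := N) (l ^ v) '' univ) ≤ 1 :=
    (dimH_mono (subset_univ _)).trans Real.dimH_univ.le
  exact mul_le_of_le_one_right' h1

lemma le_dimH_cantorMap_fibre {N : ℕ} {l κ : ℝ} (hN : 1 < N) (hl : 0 < l) (hNl : 2 * N * l < 1)
    (hκ : 0 < κ) (hNκ : 1 ≤ N * l ^ κ) (σ : ℕ → Fin 2) :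
    ENNReal.ofReal κ ≤ dimH (cantorMap (N := N) l '' {x | ∀ k, (x k).1 = σ k}) := by
  have hl1 := ratio_lt_one hN.le hNl
  have hg := cantorGap_pos hN.le hNl
  have hN0 : (0 : ℝ) < N := by exact_mod_cast (by omega : 0 < N)
  set A : Set (ℕ → Fin 2 × Fin N) := {x | ∀ k, (x k).1 = σ k}
  have key := dimH_image_le_of_holder (A := A) (p := cantorMap (N := N) l)
    (q := fun x => Real.ofDigits fun k => (x k).2) (K := 1 / cantorGap N l ^ κ)
    (by positivity) hκ (by
      intro x hx y hy
      by_cases hxy : x = y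
      · subst hxy; simp; positivity
      obtain ⟨k, h1, h2⟩ := exists_first_diff hxy
      have h3 := Real.abs_ofDigits_sub_ofDigits_le (x := fun k => (x k).2)
        (y := fun k => (y k).2) (n := k) (fun i hi => by rw [h1 i hi])
      have h4 := gap_mul_pow_le hl hl1 h1 h2
      have h5 := Real.rpow_le_rpow (by positivity) h4 hκ.le
      rw [Real.mul_rpow hg.le (by positivity)] at h5
      have h6 : ((N : ℝ) ^ k)⁻¹ ≤ (l ^ k) ^ κ := by
        rw [← Real.rpow_natCast l, ← Real.rpow_mul hl.le, mul_comm, Real.rpow_mul hl.le,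
          Real.rpow_natCast, ← inv_pow]
        gcongr
        rwa [inv_le_iff_one_le_mul₀' hN0]
      calc _ ≤ ((N : ℝ) ^ k)⁻¹ := h3
        _ ≤ (l ^ k) ^ κ := h6
        _ = 1 / cantorGap N l ^ κ * (cantorGap N l ^ κ * (l ^ k) ^ κ) := by
          field_simp
        _ ≤ _ := by gcongr)
  have h1 : Icc (0 : ℝ) 1 ⊆ (fun x : ℕ → Fin 2 × Fin N => Real.ofDigits fun k => (x k).2) '' A := by
    intro z hz
    obtain ⟨τ, -, hτ⟩ := Real.ofDigits_SurjOn hN hz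
    exact ⟨fun k => (σ k, τ k), fun k => rfl, hτ⟩
  have h2 : dimH (Icc (0 : ℝ) 1) = 1 := by
    rw [Real.dimH_of_nonempty_interior (by simp)]; simp
  have h3 := (h2.symm.le.trans (dimH_mono h1)).trans key
  rw [ENNReal.le_div_iff_mul_le (Or.inl (by simpa using hκ)) (Or.inl ENNReal.ofReal_ne_top),
    one_mul] at h3
  exact h3

lemma ofDigits_eq_zero_iff {σ : ℕ → Fin 2} : Real.ofDigits σ = 0 ↔ ∀ k, σ k = 0 := by
  constructor
  · intro h k
    have h0 : HasSum (Real.ofDigitsTerm σ) 0 := h ▸ Real.summable_ofDigitsTerm.hasSum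
    have h1 := (hasSum_zero_iff_of_nonneg (fun n => Real.ofDigitsTerm_nonneg)).mp h0
    have h2 := congrFun h1 k
    simp only [Real.ofDigitsTerm, Pi.zero_apply, mul_eq_zero] at h2
    rcases h2 with h2 | h2
    · ext; simpa using h2
    · simp at h2
  · intro h
    have : σ = fun _ => 0 := funext h
    simp [this, Real.ofDigits, Real.ofDigitsTerm]

lemma ofDigits_add_compl (σ : ℕ → Fin 2) :
    Real.ofDigits σ + Real.ofDigits (fun k => 1 - σ k) = 1 := by
  have h1 := Real.ofDigits_const_last_eq_one' (b := 2) (by norm_num)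
  rw [← h1]
  unfold Real.ofDigits
  rw [← Real.summable_ofDigitsTerm.tsum_add Real.summable_ofDigitsTerm]
  refine tsum_congr fun k => ?_
  simp only [Real.ofDigitsTerm]
  rw [← add_mul]
  congr 1
  generalize σ k = d
  fin_cases d <;> simp

lemma countable_eventually_const (c : Fin 2) :
    {σ : ℕ → Fin 2 | ∃ n, ∀ k, σ (k + n) = c}.Countable := by
  rw [ofPred_exists]
  refine countable_iUnion fun n => Set.Finite.countable ?_
  refine Set.Finite.of_injOn (f := fun (σ : ℕ → Fin 2) (i : Fin n) => σ i) (t := univ)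
    (fun _ _ => mem_univ _) ?_ finite_univ
  intro σ hσ τ hτ h
  funext k
  by_cases hk : k < n
  · exact congrFun h ⟨k, hk⟩
  · obtain ⟨j, rfl⟩ := Nat.exists_eq_add_of_le (not_lt.mp hk)
    have h1 := hσ j
    have h2 := hτ j
    rw [add_comm] at h1 h2
    rw [h1, h2]

lemma eventually_const_of_ofDigits_eq {σ τ : ℕ → Fin 2} {k : ℕ} (h1 : ∀ i < k, σ i = τ i)
    (hs : σ k = 1) (ht : τ k = 0) (h : Real.ofDigits σ = Real.ofDigits τ) :
    (∀ i, σ (i + (k + 1)) = 0) ∧ ∀ i, τ (i + (k + 1)) = 1 := by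
  rw [Real.ofDigits_eq_sum_add_ofDigits σ (k + 1), Real.ofDigits_eq_sum_add_ofDigits τ (k + 1),
    Finset.sum_range_succ, Finset.sum_range_succ] at h
  have h2 : ∑ i ∈ Finset.range k, Real.ofDigitsTerm σ i
      = ∑ i ∈ Finset.range k, Real.ofDigitsTerm τ i :=
    Finset.sum_congr rfl fun i hi => by simp [Real.ofDigitsTerm, h1 i (Finset.mem_range.mp hi)]
  rw [h2] at h
  simp only [Real.ofDigitsTerm, hs, ht] at h
  have h3 := Real.ofDigits_nonneg fun i => σ (i + (k + 1))
  have h4 := Real.ofDigits_le_one fun i => τ (i + (k + 1))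
  have h5 : 1 + Real.ofDigits (fun i => σ (i + (k + 1)))
      = Real.ofDigits fun i => τ (i + (k + 1)) := by
    have h6 : ((2 : ℝ) ^ (k + 1))⁻¹ ≠ 0 := by positivity
    apply mul_left_cancel₀ h6
    simp at h
    linarith
  have h6 : Real.ofDigits (fun i => σ (i + (k + 1))) = 0 := by linarith
  have h7 := ofDigits_add_compl fun i => τ (i + (k + 1))
  have h8 : Real.ofDigits (fun i => 1 - τ (i + (k + 1))) = 0 := by linarith
  refine ⟨ofDigits_eq_zero_iff.mp h6, fun i => ?_⟩
  exact (sub_eq_zero.mp (ofDigits_eq_zero_iff.mp h8 i)).symm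

lemma countable_ofDigits_fibre (y : ℝ) : {σ : ℕ → Fin 2 | Real.ofDigits σ = y}.Countable := by
  by_cases hsub : {σ : ℕ → Fin 2 | Real.ofDigits σ = y}.Subsingleton
  · exact hsub.countable
  have key : ∀ σ τ : ℕ → Fin 2, Real.ofDigits σ = Real.ofDigits τ → σ ≠ τ →
      σ ∈ {σ : ℕ → Fin 2 | ∃ n, ∀ k, σ (k + n) = 0} ∪ {σ : ℕ → Fin 2 | ∃ n, ∀ k, σ (k + n) = 1} := by
    intro σ τ h hne
    obtain ⟨k, h1, h2⟩ := exists_first_diff hne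
    rcases (by omega : (σ k = 1 ∧ τ k = 0) ∨ (σ k = 0 ∧ τ k = 1)) with ⟨hs, ht⟩ | ⟨hs, ht⟩
    · exact Or.inl ⟨k + 1, (eventually_const_of_ofDigits_eq h1 hs ht h).1⟩
    · exact Or.inr ⟨k + 1, (eventually_const_of_ofDigits_eq (fun i hi => (h1 i hi).symm)
        ht hs h.symm).2⟩
  refine ((countable_eventually_const 0).union (countable_eventually_const 1)).mono ?_
  intro σ hσ
  by_cases h : ∃ τ, Real.ofDigits τ = y ∧ σ ≠ τ
  · obtain ⟨τ, hτ, hne⟩ := h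
    exact key σ τ (hσ.trans hτ.symm) hne
  · push Not at h
    exact absurd (fun a ha b hb => (h a ha).symm.trans (h b hb)) hsub

lemma volume_preimage_affine {l : ℝ} (hl : 0 < l) (d : ℝ) (S : Set ℝ) :
    volume ((fun x => (x - d) / l) ⁻¹' S) = ENNReal.ofReal l * volume S := by
  have h : (fun x : ℝ => (x - d) / l) ⁻¹' S = (fun x => x + -d) ⁻¹' ((l⁻¹ * ·) ⁻¹' S) := by
    ext x; simp [div_eq_inv_mul, sub_eq_add_neg]
  rw [h, measure_preimage_add_right, Real.volume_preimage_mul_left (inv_ne_zero hl.ne'), inv_inv,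
    abs_of_pos hl]

section Thickening

variable {N : ℕ} {l u : ℝ}

lemma volume_thickening_cantor_le (hN : 1 ≤ N) (hl : 0 < l) (hNl : 2 * N * l < 1) (k : ℕ) :
    volume (thickening (l ^ k) (range (cantorMap (N := N) l)))
      ≤ ENNReal.ofReal ((2 * N * l) ^ k) * volume (thickening 1 (range (cantorMap (N := N) l))) := by
  have hl1 := ratio_lt_one hN hNl
  induction k with
  | zero => simp
  | succ k ih =>
    have hsub : thickening (l ^ (k + 1)) (range (cantorMap (N := N) l)) ⊆
        ⋃ d ∈ Finset.range (2 * N), (fun x => (x - (d : ℝ)) / l) ⁻¹'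
          thickening (l ^ k) (range (cantorMap (N := N) l)) := by
      intro x hx
      obtain ⟨_, ⟨z, rfl⟩, hz⟩ := mem_thickening_iff.mp hx
      simp only [mem_iUnion, Finset.mem_range]
      refine ⟨digitVal (z 0), digitVal_lt _, mem_thickening_iff.mpr ⟨_, ⟨fun k => z (k + 1), rfl⟩, ?_⟩⟩
      rw [cantorMap_eq hl hl1, Real.dist_eq] at hz
      rw [Real.dist_eq, div_sub' hl.ne', abs_div, abs_of_pos hl, div_lt_iff₀ hl, ← pow_succ,
        sub_sub]
      exact hz
    calc _ ≤ ∑ d ∈ Finset.range (2 * N), volume ((fun x => (x - (d : ℝ)) / l) ⁻¹'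
          thickening (l ^ k) (range (cantorMap (N := N) l))) :=
          (measure_mono hsub).trans (measure_biUnion_finset_le _ _)
      _ = (2 * N : ℕ) * (ENNReal.ofReal l * volume
          (thickening (l ^ k) (range (cantorMap (N := N) l)))) := by
          simp only [volume_preimage_affine hl, Finset.sum_const, Finset.card_range, nsmul_eq_mul]
      _ ≤ (2 * N : ℕ) * (ENNReal.ofReal l * (ENNReal.ofReal ((2 * N * l) ^ k) *
          volume (thickening 1 (range (cantorMap (N := N) l))))) := by gcongr
      _ = _ := by
          rw [pow_succ, ENNReal.ofReal_mul (by positivity), ENNReal.ofReal_mul (p := 2 * N)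
            (by positivity)]
          have : ENNReal.ofReal (2 * N) = (2 * N : ℕ) := by
            rw [← ENNReal.ofReal_natCast]; push_cast; rfl
          rw [this]
          ring

lemma isBounded_range_cantorMap (hl : 0 < l) (hl1 : l < 1) :
    Bornology.IsBounded (range (cantorMap (N := N) l)) :=
  (isBounded_Icc 0 (cantorBound N l)).subset
    (range_subset_iff.mpr fun x => ⟨cantorMap_nonneg hl x, cantorMap_le hl hl1 x⟩)

lemma volume_thickening_one_ne_top (hl : 0 < l) (hl1 : l < 1) :
    volume (thickening 1 (range (cantorMap (N := N) l))) ≠ ⊤ :=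
  (isBounded_range_cantorMap hl hl1).thickening.measure_lt_top.ne

lemma thickening_inter_ball_subset (hN : 1 ≤ N) (hl : 0 < l) (hNl : 2 * N * l < 1)
    {y ρ : ℝ} {k : ℕ} (hk : l ^ (k + 1) ≤ ρ) (hρ : ρ < cantorGap N l / 4) :
    ∃ d : ℕ, thickening (l ^ (k + 1)) (range (cantorMap (N := N) l)) ∩ ball y ρ ⊆
      (fun x => (x - (d : ℝ)) / l) ⁻¹'
        (thickening (l ^ k) (range (cantorMap (N := N) l)) ∩ ball ((y - d) / l) (ρ / l)) := by
  have hl1 := ratio_lt_one hN hNl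
  rcases (thickening (l ^ (k + 1)) (range (cantorMap (N := N) l)) ∩ ball y ρ).eq_empty_or_nonempty
    with h | ⟨x0, hx0, hy0⟩
  · exact ⟨0, by rw [h]; exact empty_subset _⟩
  obtain ⟨_, ⟨z0, rfl⟩, hz0⟩ := mem_thickening_iff.mp hx0
  refine ⟨digitVal (z0 0), ?_⟩
  rintro x ⟨hx, hy⟩
  obtain ⟨_, ⟨z, rfl⟩, hz⟩ := mem_thickening_iff.mp hx
  rw [cantorMap_eq hl hl1, Real.dist_eq] at hz hz0
  rw [mem_ball, Real.dist_eq] at hy hy0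
  have hd : digitVal (z 0) = digitVal (z0 0) := by
    by_contra hne
    have h1 := gap_le_abs_sub hl hl1 hne (fun k => z (k + 1)) (fun k => z0 (k + 1))
    rw [abs_lt] at hz hz0 hy hy0
    rcases le_abs'.mp h1 with h | h <;> linarith
  rw [hd] at hz
  refine ⟨mem_thickening_iff.mpr ⟨_, ⟨fun k => z (k + 1), rfl⟩, ?_⟩, ?_⟩
  · rw [Real.dist_eq, div_sub' hl.ne', abs_div, abs_of_pos hl, div_lt_iff₀ hl, ← pow_succ, sub_sub]
    exact hz
  · rw [mem_ball, Real.dist_eq, ← sub_div, abs_div, abs_of_pos hl, sub_sub_sub_cancel_right]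
    gcongr

lemma volume_thickening_inter_ball_le (hN : 1 ≤ N) (hl : 0 < l) (hNl : 2 * N * l < 1)
    (hu : 0 ≤ u) (hlu : 2 * N * l ^ u = 1) :
    ∃ K : ℝ, 0 ≤ K ∧ ∀ (k : ℕ) (y ρ : ℝ), l ^ k ≤ ρ →
      volume (thickening (l ^ k) (range (cantorMap (N := N) l)) ∩ ball y ρ)
        ≤ ENNReal.ofReal (K * (2 * N * l) ^ k * ρ ^ u) := by
  have hl1 := ratio_lt_one hN hNl
  have hg := cantorGap_pos hN hNl
  set E := range (cantorMap (N := N) l)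
  have hV := volume_thickening_one_ne_top (N := N) hl hl1
  set V := (volume (thickening 1 E)).toReal with hVdef
  have hV0 : 0 ≤ V := ENNReal.toReal_nonneg
  refine ⟨V / (cantorGap N l / 4) ^ u, by positivity, ?_⟩
  have large : ∀ (k : ℕ) (y ρ : ℝ), cantorGap N l / 4 ≤ ρ →
      volume (thickening (l ^ k) E ∩ ball y ρ)
        ≤ ENNReal.ofReal (V / (cantorGap N l / 4) ^ u * (2 * N * l) ^ k * ρ ^ u) := by
    intro k y ρ hρ
    refine (measure_mono inter_subset_left).trans
      ((volume_thickening_cantor_le hN hl hNl k).trans ?_)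
    rw [← ENNReal.ofReal_toReal hV, ← ENNReal.ofReal_mul (by positivity)]
    apply ENNReal.ofReal_le_ofReal
    rw [← hVdef]
    calc (2 * N * l) ^ k * V = V / (cantorGap N l / 4) ^ u * (2 * N * l) ^ k *
          (cantorGap N l / 4) ^ u := by field_simp
      _ ≤ _ := by gcongr
  intro k
  induction k with
  | zero =>
    intro y ρ hρ
    refine large 0 y ρ ?_
    have := cantorBound_nonneg hN hl hNl
    have : cantorGap N l ≤ 1 := by unfold cantorGap; nlinarith
    simp at hρ
    linarith
  | succ k ih =>
    intro y ρ hρ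
    by_cases hρg : cantorGap N l / 4 ≤ ρ
    · exact large _ y ρ hρg
    obtain ⟨d, hd⟩ := thickening_inter_ball_subset hN hl hNl (y := y) hρ (not_le.mp hρg)
    have hρ0 : 0 < ρ := lt_of_lt_of_le (by positivity) hρ
    refine (measure_mono hd).trans ?_
    rw [volume_preimage_affine hl]
    have h1 := ih ((y - d) / l) (ρ / l) (by rw [le_div_iff₀ hl, ← pow_succ]; exact hρ)
    calc _ ≤ ENNReal.ofReal l * ENNReal.ofReal (V / (cantorGap N l / 4) ^ u * (2 * N * l) ^ k *
          (ρ / l) ^ u) := by gcongr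
      _ = _ := by
        rw [← ENNReal.ofReal_mul hl.le, Real.div_rpow hρ0.le hl.le]
        congr 1
        have hlu0 : 0 < l ^ u := by positivity
        have h2 : (l ^ u)⁻¹ = 2 * N := inv_eq_of_mul_eq_one_left hlu
        rw [div_eq_mul_inv (ρ ^ u), h2]
        ring

lemma ratio_eq_rpow (hl : 0 < l) (hlu : 2 * N * l ^ u = 1) : 2 * N * l = l ^ (1 - u) := by
  have h : 0 < l ^ u := by positivity
  rw [Real.rpow_sub hl, Real.rpow_one, eq_div_iff h.ne']
  linear_combination l * hlu

lemma volume_thickening_inter_ball_le_rpow (hN : 1 ≤ N) (hl : 0 < l) (hNl : 2 * N * l < 1)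
    (hu : 0 ≤ u) (hlu : 2 * N * l ^ u = 1) {t : ℝ} (hut : u ≤ t) (ht : t ≤ 1) :
    ∃ K : ℝ, 0 ≤ K ∧ ∀ (k : ℕ) (y ρ : ℝ), 0 < ρ →
      volume (thickening (l ^ k) (range (cantorMap (N := N) l)) ∩ ball y ρ)
        ≤ ENNReal.ofReal (K * (l ^ (1 - t)) ^ k * ρ ^ t) := by
  obtain ⟨K, hK, h⟩ := volume_thickening_inter_ball_le hN hl hNl hu hlu
  rw [ratio_eq_rpow hl hlu] at h
  have hcomm : ∀ (w : ℝ) (k : ℕ), (l ^ w) ^ k = (l ^ k) ^ w := fun w k => by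
    rw [← Real.rpow_natCast (l ^ w), ← Real.rpow_mul hl.le, mul_comm w,
      Real.rpow_mul hl.le, Real.rpow_natCast]
  refine ⟨max K 2, by positivity, fun k y ρ hρ => ?_⟩
  rcases le_or_gt (l ^ k) ρ with hk | hk
  · refine (h k y ρ hk).trans (ENNReal.ofReal_le_ofReal ?_)
    have h1 : (l ^ k) ^ (1 - u) = (l ^ k) ^ (1 - t) * (l ^ k) ^ (t - u) := by
      rw [← Real.rpow_add (by positivity)]; congr 1; ring
    have h2 : ρ ^ t = ρ ^ (t - u) * ρ ^ u := by
      rw [← Real.rpow_add hρ]; congr 1; ring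
    have h3 : (l ^ k) ^ (t - u) ≤ ρ ^ (t - u) := by gcongr
    rw [hcomm, hcomm, h1, h2]
    calc K * ((l ^ k) ^ (1 - t) * (l ^ k) ^ (t - u)) * ρ ^ u
        ≤ max K 2 * ((l ^ k) ^ (1 - t) * ρ ^ (t - u)) * ρ ^ u := by
          gcongr
          exact le_max_left _ _
      _ = _ := by ring
  · refine (measure_mono inter_subset_right).trans ?_
    rw [Real.volume_ball]
    apply ENNReal.ofReal_le_ofReal
    calc 2 * ρ = 2 * ρ ^ (1 - t) * ρ ^ t := by
          rw [mul_assoc, ← Real.rpow_add hρ, sub_add_cancel, Real.rpow_one]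
      _ ≤ max K 2 * (l ^ (1 - t)) ^ k * ρ ^ t := by
          rw [hcomm]
          gcongr
          exact le_max_right _ _

end Thickening

lemma ennreal_rpow_le_rpow_of_nonpos {x y : ℝ≥0∞} {z : ℝ} (h : x ≤ y) (hz : z ≤ 0) :
    y ^ z ≤ x ^ z := by
  rw [← neg_neg z, ENNReal.rpow_neg, ENNReal.rpow_neg x, ENNReal.inv_le_inv]
  exact ENNReal.rpow_le_rpow h (by linarith)

lemma rpow_infEDist_le_tsum {E : Set ℝ} {l η : ℝ} (hl : 0 < l) (hl1 : l < 1) (hη : η ≤ 1) (x : ℝ) :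
    infEDist x E ^ (η - 1) ≤ 1 + ∑' k : ℕ, ENNReal.ofReal ((l ^ (k + 1)) ^ (η - 1)) *
      (thickening (l ^ k) E).indicator 1 x := by
  have hη' : η - 1 ≤ 0 := by linarith
  rcases le_or_gt 1 (infEDist x E) with h1 | h1
  · refine le_trans ?_ le_self_add
    simpa using ennreal_rpow_le_rpow_of_nonpos h1 hη'
  refine le_trans ?_ le_add_self
  rcases eq_or_ne (infEDist x E) 0 with h0 | h0
  · have : ∑' _ : ℕ, (1 : ℝ≥0∞) = ⊤ := ENNReal.tsum_const_eq_top_of_ne_zero one_ne_zero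
    refine le_top.trans (this ▸ ENNReal.tsum_le_tsum fun k => ?_)
    have hk : x ∈ thickening (l ^ k) E := by
      rw [mem_thickening_iff_infEDist_lt, h0]
      simpa using pow_pos hl k
    rw [indicator_of_mem hk, Pi.one_apply, mul_one, ENNReal.one_le_ofReal]
    exact Real.one_le_rpow_of_pos_of_le_one_of_nonpos (by positivity)
      (pow_le_one₀ hl.le hl1.le) hη'
  have hex : ∃ n : ℕ, ENNReal.ofReal (l ^ n) ≤ infEDist x E := by
    obtain ⟨n, hn⟩ := exists_pow_lt_of_lt_one (ENNReal.toReal_pos h0 h1.ne_top) hl1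
    exact ⟨n, ENNReal.ofReal_le_of_le_toReal hn.le⟩
  obtain ⟨k, hk⟩ : ∃ k, Nat.find hex = k + 1 := by
    refine Nat.exists_eq_succ_of_ne_zero fun h => ?_
    have := Nat.find_spec hex
    rw [h] at this
    simp only [pow_zero, ENNReal.ofReal_one] at this
    exact absurd h1 (not_lt.mpr this)
  refine le_trans ?_ (ENNReal.le_tsum k)
  have hmem : x ∈ thickening (l ^ k) E := by
    rw [mem_thickening_iff_infEDist_lt]
    exact not_le.mp (Nat.find_min hex (by omega))
  rw [indicator_of_mem hmem, Pi.one_apply, mul_one, ← ENNReal.ofReal_rpow_of_pos (by positivity),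
    ← hk]
  exact ennreal_rpow_le_rpow_of_nonpos (Nat.find_spec hex) hη'

lemma setLIntegral_rpow_infEDist_le {N : ℕ} {l u t η : ℝ} (hN : 1 ≤ N) (hl : 0 < l)
    (hNl : 2 * N * l < 1) (hu : 0 ≤ u) (hlu : 2 * N * l ^ u = 1) (hut : u ≤ t) (htη : t < η)
    (hη : η ≤ 1) :
    ∃ K : ℝ, 0 ≤ K ∧ ∀ y ρ : ℝ, 0 < ρ → ρ ≤ 1 →
      ∫⁻ x in ball y ρ, infEDist x (range (cantorMap (N := N) l)) ^ (η - 1)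
        ≤ ENNReal.ofReal (K * ρ ^ t) := by
  have hl1 := ratio_lt_one hN hNl
  obtain ⟨K, hK, h⟩ := volume_thickening_inter_ball_le_rpow hN hl hNl hu hlu hut (by linarith)
  set E := range (cantorMap (N := N) l)
  have hr0 : 0 < l ^ (η - t) := by positivity
  have hr1 : l ^ (η - t) < 1 := Real.rpow_lt_one hl.le hl1 (by linarith)
  set M := K * l ^ (η - 1) * (1 - l ^ (η - t))⁻¹
  have hM : 0 ≤ M := mul_nonneg (by positivity) (inv_nonneg.mpr (by linarith))
  refine ⟨2 + M, by positivity, fun y ρ hρ hρ1 => ?_⟩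
  have hmeas : ∀ k : ℕ, Measurable fun x => ENNReal.ofReal ((l ^ (k + 1)) ^ (η - 1)) *
      (thickening (l ^ k) E).indicator (1 : ℝ → ℝ≥0∞) x := fun k =>
    ((measurable_one.indicator isOpen_thickening.measurableSet).const_mul _)
  calc ∫⁻ x in ball y ρ, infEDist x E ^ (η - 1)
      ≤ ∫⁻ x in ball y ρ, (1 + ∑' k : ℕ, ENNReal.ofReal ((l ^ (k + 1)) ^ (η - 1)) *
          (thickening (l ^ k) E).indicator 1 x) :=
        lintegral_mono fun x => rpow_infEDist_le_tsum hl hl1 hη x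
    _ = volume (ball y ρ) + ∑' k : ℕ, ENNReal.ofReal ((l ^ (k + 1)) ^ (η - 1)) *
          volume (thickening (l ^ k) E ∩ ball y ρ) := by
        rw [lintegral_add_left measurable_const, lintegral_tsum fun k => (hmeas k).aemeasurable]
        congr 1
        · simp
        · refine tsum_congr fun k => ?_
          rw [lintegral_const_mul _ (measurable_one.indicator isOpen_thickening.measurableSet),
            lintegral_indicator_one isOpen_thickening.measurableSet,
            Measure.restrict_apply isOpen_thickening.measurableSet]
    _ ≤ ENNReal.ofReal (2 * ρ ^ t) + ∑' k : ℕ, ENNReal.ofReal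
          (K * l ^ (η - 1) * ρ ^ t * (l ^ (η - t)) ^ k) := by
        gcongr with k
        · rw [Real.volume_ball]
          apply ENNReal.ofReal_le_ofReal
          gcongr
          simpa using Real.rpow_le_rpow_of_exponent_ge hρ hρ1 (by linarith : t ≤ 1)
        · refine (mul_le_mul_right (h k y ρ hρ) _).trans ?_
          rw [← ENNReal.ofReal_mul (by positivity)]
          apply ENNReal.ofReal_le_ofReal (le_of_eq _)
          have hp : ∀ w : ℝ, (l ^ w) ^ k = l ^ (w * k) := fun w => by
            rw [Real.rpow_mul hl.le, Real.rpow_natCast]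
          have h1 : (l ^ (k + 1)) ^ (η - 1) = l ^ ((η - 1) * k) * l ^ (η - 1) := by
            rw [← Real.rpow_natCast l (k + 1), ← Real.rpow_mul hl.le, ← Real.rpow_add hl]
            congr 1; push_cast; ring
          have h2 : l ^ ((η - 1) * k) * l ^ ((1 - t) * k) = l ^ ((η - t) * k) := by
            rw [← Real.rpow_add hl]; congr 1; ring
          rw [hp, hp, h1, ← h2]
          ring
    _ = ENNReal.ofReal ((2 + M) * ρ ^ t) := by
        rw [← ENNReal.ofReal_tsum_of_nonneg (fun k => by positivity)
          ((summable_geometric_of_lt_one hr0.le hr1).mul_left _), tsum_mul_left,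
          tsum_geometric_of_lt_one hr0.le hr1, ← ENNReal.ofReal_add (by positivity)]
        · congr 1; simp only [M]; ring
        · exact mul_nonneg (by positivity) (inv_nonneg.mpr (by linarith))

/-- A measure `ν` living on the interval `(p, q)`, with a density which is bounded off a closed null
set `C ⊆ (p, q)`, and such that the local dimension of `ν` at the points of `C` is `H`; the level
sets of `H` in `C` have dimension in `[κ, v]`. -/
structure IsPiece (a b κ v t δ p q : ℝ) (ν : Measure ℝ) (C : Set ℝ) (H : ℝ → ℝ) : Prop where
  isClosed : IsClosed C
  volume_eq_zero : volume C = 0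
  subset_Ioo : C ⊆ Ioo p q
  mem_Icc : ∀ x ∈ C, H x ∈ Icc a b
  measure_univ_le : ν univ ≤ ENNReal.ofReal δ
  measure_compl : ν (Ioo p q)ᶜ = 0
  ball_le : ∀ x ρ, 0 < ρ → ν (ball x ρ) ≤ ENNReal.ofReal (δ * ρ ^ t)
  ball_le_of_notMem : ∀ x ∉ C, ∃ K : ℝ, ∀ ρ, 0 < ρ → ν (ball x ρ) ≤ ENNReal.ofReal (K * ρ)
  ball_le_of_lt : ∀ x ∈ C, ∀ w, 0 ≤ w → w < H x →
    ∃ K : ℝ, ∀ ρ, 0 < ρ → ν (ball x ρ) ≤ ENNReal.ofReal (K * ρ ^ w)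
  le_ball : ∀ x ∈ C, ∀ w, H x < w →
    ∃ c > 0, ∃ r > 0, ∀ ρ ∈ Ioo 0 r, ENNReal.ofReal (c * ρ ^ w) ≤ ν (ball x ρ)
  nonempty_level : ∀ h ∈ Icc a b, (C ∩ H ⁻¹' {h}).Nonempty
  le_dimH_level : ∀ h ∈ Icc a b, ENNReal.ofReal κ ≤ dimH (C ∩ H ⁻¹' {h})
  dimH_level_le : ∀ h ∈ Icc a b, h < 1 → dimH (C ∩ H ⁻¹' {h}) ≤ ENNReal.ofReal v

lemma ball_le_of_small {ν : Measure ℝ} {x K₀ M r t : ℝ} (hr : 0 < r) (ht : 0 ≤ t)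
    (hM : ν univ ≤ ENNReal.ofReal M)
    (h : ∀ ρ, 0 < ρ → ρ ≤ r → ν (ball x ρ) ≤ ENNReal.ofReal (K₀ * ρ ^ t)) {ρ : ℝ} (hρ : 0 < ρ) :
    ν (ball x ρ) ≤ ENNReal.ofReal (max K₀ (M / r ^ t) * ρ ^ t) := by
  rcases le_or_gt ρ r with h1 | h1
  · refine (h ρ hρ h1).trans (ENNReal.ofReal_le_ofReal ?_)
    gcongr
    exact le_max_left _ _
  · refine ((measure_mono (subset_univ _)).trans hM).trans ?_
    rcases le_or_gt M 0 with hM0 | hM0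
    · rw [ENNReal.ofReal_of_nonpos hM0]; exact zero_le
    apply ENNReal.ofReal_le_ofReal
    have hrt : 0 < r ^ t := by positivity
    calc M = M / r ^ t * r ^ t := by field_simp
      _ ≤ M / r ^ t * ρ ^ t := by gcongr
      _ ≤ _ := by gcongr; exact le_max_right _ _

/-- The measure with density `dist(x, E) ^ (φ x - 1)`. -/
noncomputable def potential (E : Set ℝ) (φ : ℝ → ℝ) : Measure ℝ :=
  volume.withDensity fun x => infEDist x E ^ (φ x - 1)

section Potential

variable {E : Set ℝ} {φ : ℝ → ℝ}

lemma potential_ball (y ρ : ℝ) :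
    potential E φ (ball y ρ) = ∫⁻ x in ball y ρ, infEDist x E ^ (φ x - 1) :=
  withDensity_apply _ measurableSet_ball

lemma potential_ball_le {K t η y ρ : ℝ} (hK : 0 ≤ K) (ht : t ≤ 1) (hρ : 0 < ρ)
    (hρ1 : ρ ≤ 1) (hφ1 : ∀ x, φ x ≤ 1) (hφ : ∀ x ∈ ball y ρ, η ≤ φ x)
    (h : ∫⁻ x in ball y ρ, infEDist x E ^ (η - 1) ≤ ENNReal.ofReal (K * ρ ^ t)) :
    potential E φ (ball y ρ) ≤ ENNReal.ofReal ((2 + K) * ρ ^ t) := by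
  rw [potential_ball]
  calc ∫⁻ x in ball y ρ, infEDist x E ^ (φ x - 1)
      ≤ ∫⁻ x in ball y ρ, (1 + infEDist x E ^ (η - 1)) := by
        refine setLIntegral_mono' measurableSet_ball fun x hx => ?_
        rcases le_total 1 (infEDist x E) with h1 | h1
        · refine le_trans ?_ le_self_add
          simpa using ennreal_rpow_le_rpow_of_nonpos h1 (by linarith [hφ1 x] : φ x - 1 ≤ 0)
        · refine le_trans ?_ le_add_self
          exact ENNReal.rpow_le_rpow_of_exponent_ge h1 (by linarith [hφ x hx])
    _ = volume (ball y ρ) + ∫⁻ x in ball y ρ, infEDist x E ^ (η - 1) := by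
        rw [lintegral_add_left measurable_const]; simp
    _ ≤ ENNReal.ofReal (2 * ρ ^ t) + ENNReal.ofReal (K * ρ ^ t) := by
        gcongr
        rw [Real.volume_ball]
        apply ENNReal.ofReal_le_ofReal
        gcongr
        simpa using Real.rpow_le_rpow_of_exponent_ge hρ hρ1 ht
    _ = _ := by
        rw [← ENNReal.ofReal_add (by positivity) (by positivity)]; congr 1; ring

lemma exists_potential_ball_le_of_notMem (hE : IsClosed E) (hφ0 : ∀ x, 0 ≤ φ x)
    (hφ1 : ∀ x, φ x ≤ 1) {x : ℝ} (hx : x ∉ E) :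
    ∃ K r : ℝ, 0 < r ∧ ∀ ρ, 0 < ρ → ρ ≤ r → potential E φ (ball x ρ) ≤ ENNReal.ofReal (K * ρ) := by
  obtain ⟨ε, hε, hlt⟩ := exists_real_pos_lt_infEDist_of_notMem_closure (hE.closure_eq.symm ▸ hx)
  set r := min ε 1 / 2
  have hr : 0 < r := by positivity
  have hr1 : r ≤ 1 := by have := min_le_right ε 1; simp only [r]; linarith
  have hrε : r + r ≤ ε := by have := min_le_left ε 1; simp only [r]; linarith
  refine ⟨2 / r, r, hr, fun ρ hρ hρr => ?_⟩
  rw [potential_ball]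
  calc ∫⁻ z in ball x ρ, infEDist z E ^ (φ z - 1)
      ≤ ∫⁻ z in ball x ρ, ENNReal.ofReal (1 / r) := by
        refine setLIntegral_mono' measurableSet_ball fun z hz => ?_
        have hd : ENNReal.ofReal r ≤ infEDist z E := by
          have h1 : infEDist x E ≤ edist x z + infEDist z E := infEDist_le_edist_add_infEDist
          have h2 : edist x z ≤ ENNReal.ofReal r := by
            rw [edist_comm, edist_dist]
            exact ENNReal.ofReal_le_ofReal ((mem_ball.mp hz).le.trans hρr)
          by_contra hcon
          have h3 := ENNReal.add_lt_add_of_le_of_lt (by simp) h2 (not_le.mp hcon)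
          rw [← ENNReal.ofReal_add hr.le hr.le] at h3
          exact absurd ((h1.trans_lt h3).trans_le (ENNReal.ofReal_le_ofReal hrε))
            (not_lt.mpr hlt.le)
        calc infEDist z E ^ (φ z - 1) ≤ ENNReal.ofReal r ^ (φ z - 1) :=
              ennreal_rpow_le_rpow_of_nonpos hd (by linarith [hφ1 z])
          _ ≤ ENNReal.ofReal r ^ (-1 : ℝ) :=
              ENNReal.rpow_le_rpow_of_exponent_ge (ENNReal.ofReal_le_one.mpr hr1)
                (by linarith [hφ0 z])
          _ = ENNReal.ofReal (1 / r) := by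
              rw [ENNReal.ofReal_rpow_of_pos hr, Real.rpow_neg_one, one_div]
    _ = _ := by
        rw [setLIntegral_const, Real.volume_ball, ← ENNReal.ofReal_mul (by positivity)]
        congr 1; ring

lemma le_potential_ball {x w ρ : ℝ} (hx : x ∈ E) (hφ1 : ∀ x, φ x ≤ 1) (hρ : 0 < ρ) (hρ1 : ρ ≤ 1)
    (hφ : ∀ z ∈ ball x ρ, φ z ≤ w) : ENNReal.ofReal (2 * ρ ^ w) ≤ potential E φ (ball x ρ) := by
  rw [potential_ball]
  calc ENNReal.ofReal (2 * ρ ^ w) = ∫⁻ z in ball x ρ, ENNReal.ofReal (ρ ^ (w - 1)) := by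
        rw [setLIntegral_const, Real.volume_ball, ← ENNReal.ofReal_mul (by positivity),
          Real.rpow_sub hρ, Real.rpow_one]
        congr 1; field_simp
    _ ≤ _ := by
        refine setLIntegral_mono' measurableSet_ball fun z hz => ?_
        have hd : infEDist z E ≤ ENNReal.ofReal ρ := by
          refine (infEDist_le_edist_of_mem hx).trans ?_
          rw [edist_dist]
          exact ENNReal.ofReal_le_ofReal (mem_ball.mp hz).le
        calc ENNReal.ofReal (ρ ^ (w - 1)) = ENNReal.ofReal ρ ^ (w - 1) :=
              (ENNReal.ofReal_rpow_of_pos hρ).symm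
          _ ≤ ENNReal.ofReal ρ ^ (φ z - 1) :=
              ENNReal.rpow_le_rpow_of_exponent_ge (ENNReal.ofReal_le_one.mpr hρ1)
                (by linarith [hφ z hz])
          _ ≤ _ := ennreal_rpow_le_rpow_of_nonpos hd (by linarith [hφ1 z])

end Potential

lemma rpow_le_of_small {K ρ s t : ℝ} (hK : 0 ≤ K) (hρ : 0 < ρ) (hρ1 : ρ ≤ 1) (h : s ≤ t) :
    ENNReal.ofReal (K * ρ ^ t) ≤ ENNReal.ofReal (K * ρ ^ s) :=
  ENNReal.ofReal_le_ofReal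
    (mul_le_mul_of_nonneg_left (Real.rpow_le_rpow_of_exponent_ge hρ hρ1 h) hK)

/-- The restriction to a bounded interval of the measure `potential E φ`, where `E` is a
self-similar Cantor set, is a piece. -/
lemma exists_isPiece_cantor {N : ℕ} {l u a b κ v t : ℝ} (hN : 1 ≤ N) (hl : 0 < l)
    (hNl : 2 * N * l < 1) (hu : 0 ≤ u) (hlu : 2 * N * l ^ u = 1) (hua : u < a) (hab : a ≤ b)
    (hb : b ≤ 1) (ht : 0 ≤ t) (hta : t < a)
    (hlow : ∀ σ : ℕ → Fin 2,
      ENNReal.ofReal κ ≤ dimH (cantorMap (N := N) l '' {x | ∀ k, (x k).1 = σ k}))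
    (hup : ∀ h ∈ Icc a b, h < 1 → dimH (cantorMap (N := N) l ''
      {x | a + (b - a) * Real.ofDigits (fun k => (x k).1) = h}) ≤ ENNReal.ofReal v) :
    ∃ δ p q ν C H, 0 < δ ∧ p < q ∧ IsPiece a b κ v t δ p q ν C H := by
  have hl1 := ratio_lt_one hN hNl
  set E := range (cantorMap (N := N) l) with hE
  have hEc : IsClosed E := (isClosedEmbedding_cantorMap hN hl hNl).isClosed_range
  set g : (ℕ → Fin 2 × Fin N) → ℝ := fun x => a + (b - a) * Real.ofDigits (fun k => (x k).1)
    with hg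
  have hgc : Continuous g := by
    have h1 : Continuous fun x : ℕ → Fin 2 × Fin N => fun k => (x k).1 := by fun_prop
    exact continuous_const.add (continuous_const.mul (Real.continuous_ofDigits.comp h1))
  have hgm : ∀ x, g x ∈ Icc a b := fun x => by
    have h0 := Real.ofDigits_nonneg (fun k => (x k).1)
    have h1 := Real.ofDigits_le_one (fun k => (x k).1)
    constructor <;> simp only [hg] <;> nlinarith
  obtain ⟨φ, hφm, hφg⟩ := ContinuousMap.exists_extension_forall_mem_of_isClosedEmbedding
    (⟨g, hgc⟩ : C(ℕ → Fin 2 × Fin N, ℝ)) hgm (nonempty_Icc.mpr hab)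
    (isClosedEmbedding_cantorMap hN hl hNl)
  have hφE : ∀ x, φ (cantorMap l x) = g x := fun x => congrFun hφg x
  have hφ0 : ∀ x, 0 ≤ φ x := fun x => by linarith [(hφm x).1]
  have hφ1 : ∀ x, φ x ≤ 1 := fun x => (hφm x).2.trans hb
  have ha1 : a ≤ 1 := hab.trans hb
  have hunif : ∀ w, w < a → ∃ K : ℝ, 0 ≤ K ∧ ∀ y ρ, 0 < ρ → ρ ≤ 1 →
      potential E φ (ball y ρ) ≤ ENNReal.ofReal (K * ρ ^ w) := by
    intro w hw
    obtain ⟨K, hK, h⟩ := setLIntegral_rpow_infEDist_le (t := max u w) hN hl hNl hu hlu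
      (le_max_left _ _) (max_lt hua hw) ha1
    refine ⟨2 + K, by positivity, fun y ρ hρ hρ1 => ?_⟩
    refine (potential_ball_le hK ((max_lt hua hw).le.trans ha1) hρ hρ1 hφ1
      (fun x _ => (hφm x).1) (h y ρ hρ hρ1)).trans ?_
    exact rpow_le_of_small (by positivity) hρ hρ1 (le_max_right _ _)
  have hlf : IsLocallyFiniteMeasure (potential E φ) := by
    obtain ⟨K, -, h⟩ := hunif u hua
    exact ⟨fun x => ⟨ball x 1, ball_mem_nhds x one_pos,
      (h x 1 one_pos le_rfl).trans_lt ENNReal.ofReal_lt_top⟩⟩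
  set p : ℝ := -1
  set q : ℝ := cantorBound N l + 1
  have hB := cantorBound_nonneg hN hl hNl
  set ν := (potential E φ).restrict (Ioo p q) with hν
  have hνle : ∀ s, ν s ≤ potential E φ s := fun s => Measure.restrict_apply_le _ s
  have hfin : ν univ ≠ ⊤ := by
    rw [hν, Measure.restrict_apply_univ]
    exact (isBounded_Ioo p q).measure_lt_top.ne
  have hM : ν univ ≤ ENNReal.ofReal (ν univ).toReal := (ENNReal.ofReal_toReal hfin).ge
  obtain ⟨K₁, hK₁, hball⟩ := hunif t hta
  have hEsub : ∀ x ∈ E, x ∈ Icc 0 (cantorBound N l) := by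
    rintro _ ⟨x, rfl⟩
    exact ⟨cantorMap_nonneg hl x, cantorMap_le hl hl1 x⟩
  have hlevel : ∀ h, E ∩ φ ⁻¹' {h} = cantorMap l '' {x | g x = h} := by
    intro h
    ext y
    constructor
    · rintro ⟨⟨x, rfl⟩, hx⟩
      exact ⟨x, (hφE x).symm.trans hx, rfl⟩
    · rintro ⟨x, hx, rfl⟩
      exact ⟨⟨x, rfl⟩, (hφE x).trans hx⟩
  have hdig : ∀ h ∈ Icc a b, ∃ σ : ℕ → Fin 2, ∀ x : ℕ → Fin 2 × Fin N,
      (∀ k, (x k).1 = σ k) → g x = h := by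
    intro h hh
    obtain ⟨y, hy, hyh⟩ : ∃ y ∈ Icc (0 : ℝ) 1, a + (b - a) * y = h := by
      rcases hab.eq_or_lt with rfl | hlt
      · exact ⟨0, by simp, by simpa using le_antisymm hh.1 hh.2⟩
      · refine ⟨(h - a) / (b - a), ⟨div_nonneg (by linarith [hh.1]) (by linarith), ?_⟩, ?_⟩
        · rw [div_le_one (by linarith)]; linarith [hh.2]
        · have : b - a ≠ 0 := by linarith
          field_simp; ring
    obtain ⟨σ, -, hσ⟩ := Real.ofDigits_SurjOn (b := 2) (by norm_num) hy
    refine ⟨σ, fun x hx => ?_⟩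
    simp only [hg]
    rw [funext hx, hσ, hyh]
  refine ⟨max (max K₁ ((ν univ).toReal / 1 ^ t)) (max 1 (ν univ).toReal), p, q, ν, E, φ,
    by positivity, by simp only [p, q]; linarith, ?_⟩
  constructor
  · exact hEc
  · have h0 : Tendsto (fun k => ENNReal.ofReal ((2 * N * l) ^ k) * volume (thickening 1 E)) atTop
        (𝓝 (ENNReal.ofReal 0 * volume (thickening 1 E))) :=
      ENNReal.Tendsto.mul_const (ENNReal.tendsto_ofReal
        (tendsto_pow_atTop_nhds_zero_of_lt_one (by positivity) hNl))
        (Or.inr (volume_thickening_one_ne_top hl hl1))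
    rw [ENNReal.ofReal_zero, zero_mul] at h0
    refine le_antisymm (ge_of_tendsto' h0 fun k => ?_) zero_le
    exact (measure_mono (self_subset_thickening (by positivity) _)).trans
      (volume_thickening_cantor_le hN hl hNl k)
  · intro x hx
    have := hEsub x hx
    exact ⟨by simp only [p]; linarith [this.1], by simp only [q]; linarith [this.2]⟩
  · exact fun x _ => hφm x
  · exact hM.trans (ENNReal.ofReal_le_ofReal ((le_max_right _ _).trans (le_max_right _ _)))
  · rw [hν, Measure.restrict_apply measurableSet_Ioo.compl, compl_inter_self, measure_empty]
  · intro x ρ hρ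
    refine (ball_le_of_small one_pos ht hM (fun ρ hρ hρ1 => (hνle _).trans (hball x ρ hρ hρ1))
      hρ).trans (ENNReal.ofReal_le_ofReal ?_)
    exact mul_le_mul_of_nonneg_right (le_max_left _ _) (by positivity)
  · intro x hx
    obtain ⟨K, r, hr, h⟩ := exists_potential_ball_le_of_notMem hEc hφ0 hφ1 hx
    refine ⟨max K ((ν univ).toReal / r ^ (1 : ℝ)), fun ρ hρ => ?_⟩
    have := ball_le_of_small hr zero_le_one hM
      (fun ρ hρ hρr => (hνle _).trans (by simpa using h ρ hρ hρr)) hρ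
    rwa [Real.rpow_one ρ] at this
  · intro x hx w hw hwx
    have hux : u < φ x := hua.trans_le (hφm x).1
    obtain ⟨η, hη1, hη2⟩ := exists_between (max_lt hux hwx)
    obtain ⟨r, hr, hrη⟩ : ∃ r > 0, ∀ z ∈ ball x r, η < φ z :=
      Metric.eventually_nhds_iff_ball.mp (φ.continuous.continuousAt.eventually_const_lt hη2)
    have hη' : η ≤ 1 := hη2.le.trans (hφ1 x)
    obtain ⟨K, hK, h⟩ := setLIntegral_rpow_infEDist_le (t := max u w) hN hl hNl hu hlu
      (le_max_left _ _) hη1 hη'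
    refine ⟨_, fun ρ hρ => ball_le_of_small (r := min r 1) (K₀ := 2 + K) (by positivity) hw hM
      (fun ρ hρ hρr => (hνle _).trans ?_) hρ⟩
    have hρ1 : ρ ≤ 1 := hρr.trans (min_le_right _ _)
    refine (potential_ball_le hK (hη1.le.trans hη') hρ hρ1 hφ1 (fun z hz => (hrη z ?_).le)
      (h x ρ hρ hρ1)).trans (rpow_le_of_small (by positivity) hρ hρ1 (le_max_right _ _))
    exact ball_subset_ball (hρr.trans (min_le_left _ _)) hz
  · intro x hx w hwx
    obtain ⟨r, hr, hrw⟩ : ∃ r > 0, ∀ z ∈ ball x r, φ z < w :=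
      Metric.eventually_nhds_iff_ball.mp (φ.continuous.continuousAt.eventually_lt_const hwx)
    refine ⟨2, two_pos, min r 1, by positivity, fun ρ hρ => ?_⟩
    have hρ1 : ρ ≤ 1 := hρ.2.le.trans (min_le_right _ _)
    have hsub : ball x ρ ⊆ Ioo p q := by
      rw [Real.ball_eq_Ioo]
      have := hEsub x hx
      exact Ioo_subset_Ioo (by simp only [p]; linarith [this.1])
        (by simp only [q]; linarith [this.2])
    rw [hν, Measure.restrict_eq_self _ hsub]
    exact le_potential_ball hx hφ1 hρ.1 hρ1 fun z hz =>
      (hrw z (ball_subset_ball (hρ.2.le.trans (min_le_left _ _)) hz)).le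
  · intro h hh
    obtain ⟨σ, hσ⟩ := hdig h hh
    rw [hlevel]
    exact ⟨_, mem_image_of_mem _ (hσ (fun k => (σ k, ⟨0, hN⟩)) fun k => rfl)⟩
  · intro h hh
    obtain ⟨σ, hσ⟩ := hdig h hh
    rw [hlevel]
    exact (hlow σ).trans (dimH_mono (image_mono fun x hx => hσ x hx))
  · intro h hh hh1
    rw [hlevel]
    exact hup h hh hh1

lemma dimH_preimage_affine {s : ℝ} (hs : 0 < s) (d : ℝ) (S : Set ℝ) :
    dimH ((fun x => (x - d) / s) ⁻¹' S) = dimH S := by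
  have hset : (fun x => (x - d) / s) ⁻¹' S = (fun x => d + s * x) '' S := by
    ext y
    constructor
    · intro hy
      exact ⟨_, hy, by field_simp; ring⟩
    · rintro ⟨x, hx, rfl⟩
      simpa [hs.ne'] using hx
  have hdist : ∀ x y, dist (d + s * x) (d + s * y) = s * dist x y := fun x y => by
    rw [Real.dist_eq, Real.dist_eq, add_sub_add_left_eq_sub, ← mul_sub, abs_mul, abs_of_pos hs]
  rw [hset]
  refine le_antisymm ?_ ?_
  · refine (LipschitzWith.of_dist_le_mul (K := s.toNNReal) fun x y => ?_).dimH_image_le S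
    rw [hdist, Real.coe_toNNReal _ hs.le]
  · refine (AntilipschitzWith.of_le_mul_dist (K := s⁻¹.toNNReal) fun x y => ?_).le_dimH_image S
    rw [hdist, Real.coe_toNNReal _ (by positivity)]
    field_simp
    exact le_rfl

lemma preimage_affine_ball {s : ℝ} (hs : 0 < s) (d y ρ : ℝ) :
    (fun x => d + s * x) ⁻¹' ball y ρ = ball ((y - d) / s) (ρ / s) := by
  ext x
  rw [mem_preimage, mem_ball, mem_ball, Real.dist_eq, Real.dist_eq, lt_div_iff₀ hs,
    ← abs_of_pos hs, ← abs_mul, abs_of_pos hs]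
  have : (x - (y - d) / s) * s = d + s * x - y := by field_simp; ring
  rw [this]

lemma IsPiece.rescale {a b κ v t δ p q δ' p' q' : ℝ} {ν : Measure ℝ} {C : Set ℝ} {H : ℝ → ℝ}
    (h : IsPiece a b κ v t δ p q ν C H) (hδ : 0 < δ) (hpq : p < q) (hδ' : 0 < δ')
    (hpq' : p' < q') : ∃ ν' C' H', IsPiece a b κ v t δ' p' q' ν' C' H' := by
  obtain ⟨s, hs, d, hp, hq⟩ : ∃ s > 0, ∃ d, d + s * p = p' ∧ d + s * q = q' := by
    have hqp : 0 < q - p := by linarith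
    refine ⟨(q' - p') / (q - p), div_pos (by linarith) hqp,
      p' - (q' - p') / (q - p) * p, by ring, ?_⟩
    field_simp; ring
  set k : ℝ → ℝ := fun x => (x - d) / s with hk
  have hkc : Continuous k := by fun_prop
  set m := max 1 (s ^ t)⁻¹ with hm
  have hm0 : 0 < m := by positivity
  set c := δ' / (δ * m) with hc
  have hc0 : 0 < c := by positivity
  have hgm : Measurable fun x => d + s * x := by fun_prop
  set ν' := ENNReal.ofReal c • ν.map (fun x => d + s * x) with hν'
  have hball : ∀ y ρ, ν' (ball y ρ) = ENNReal.ofReal c * ν (ball (k y) (ρ / s)) := fun y ρ => by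
    rw [hν', Measure.smul_apply, smul_eq_mul, Measure.map_apply hgm measurableSet_ball,
      preimage_affine_ball hs]
  have hpow : ∀ (K w : ℝ) {ρ}, 0 < ρ → ENNReal.ofReal c * ENNReal.ofReal (K * (ρ / s) ^ w)
      = ENNReal.ofReal (c * K * (s ^ w)⁻¹ * ρ ^ w) := fun K w ρ hρ => by
    rw [← ENNReal.ofReal_mul hc0.le, Real.div_rpow hρ.le hs.le]
    congr 1
    ring
  refine ⟨ν', k ⁻¹' C, H ∘ k, ?_⟩
  constructor
  · exact h.isClosed.preimage hkc
  · rw [volume_preimage_affine hs, h.volume_eq_zero, mul_zero]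
  · intro x hx
    obtain ⟨h1, h2⟩ := h.subset_Ioo hx
    rw [hk] at h1 h2
    rw [lt_div_iff₀ hs] at h1
    rw [div_lt_iff₀ hs] at h2
    constructor <;> nlinarith
  · exact fun x hx => h.mem_Icc _ hx
  · rw [hν', Measure.smul_apply, smul_eq_mul, Measure.map_apply hgm MeasurableSet.univ,
      preimage_univ]
    refine (mul_le_mul_right h.measure_univ_le _).trans ?_
    rw [← ENNReal.ofReal_mul hc0.le]
    apply ENNReal.ofReal_le_ofReal
    rw [hc, div_mul_eq_mul_div, div_le_iff₀ (by positivity), mul_comm δ m, ← mul_assoc]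
    gcongr
    exact le_mul_of_one_le_right hδ'.le (le_max_left _ _)
  · rw [hν', Measure.smul_apply, smul_eq_mul, Measure.map_apply hgm measurableSet_Ioo.compl]
    have : (fun x => d + s * x) ⁻¹' (Ioo p' q')ᶜ = (Ioo p q)ᶜ := by
      rw [preimage_compl, ← hp, ← hq]
      congr 1
      ext x
      simp [hs]
    rw [this, h.measure_compl, mul_zero]
  · intro x ρ hρ
    rw [hball]
    refine (mul_le_mul_right (h.ball_le (k x) (ρ / s) (by positivity)) _).trans ?_
    rw [hpow _ _ hρ]
    apply ENNReal.ofReal_le_ofReal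
    gcongr
    rw [hc, div_mul_eq_mul_div, div_mul_eq_mul_div, div_le_iff₀ (by positivity), mul_assoc]
    gcongr
    exact le_max_right _ _
  · intro x hx
    obtain ⟨K, hK⟩ := h.ball_le_of_notMem (k x) hx
    refine ⟨c * K * (s ^ (1 : ℝ))⁻¹, fun ρ hρ => ?_⟩
    have := mul_le_mul_right (hK (ρ / s) (by positivity)) (ENNReal.ofReal c)
    rw [hball]
    have h2 := hpow K 1 hρ
    rw [Real.rpow_one (ρ / s), Real.rpow_one ρ] at h2
    rwa [h2] at this
  · intro x hx w hw hwx
    obtain ⟨K, hK⟩ := h.ball_le_of_lt (k x) hx w hw hwx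
    refine ⟨c * K * (s ^ w)⁻¹, fun ρ hρ => ?_⟩
    rw [hball]
    exact (mul_le_mul_right (hK (ρ / s) (by positivity)) _).trans (hpow _ _ hρ).le
  · intro x hx w hwx
    obtain ⟨c', hc', r, hr, hK⟩ := h.le_ball (k x) hx w hwx
    refine ⟨c * c' * (s ^ w)⁻¹, by positivity, r * s, by positivity, fun ρ hρ => ?_⟩
    rw [hball, ← hpow _ _ hρ.1]
    gcongr
    exact hK _ ⟨div_pos hρ.1 hs, (div_lt_iff₀ hs).mpr hρ.2⟩
  · intro y hy
    obtain ⟨x, hx⟩ := h.nonempty_level y hy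
    refine ⟨d + s * x, ?_⟩
    have : k (d + s * x) = x := by simp [hk, hs.ne']
    simpa [this] using hx
  · intro y hy
    exact (h.le_dimH_level y hy).trans (dimH_preimage_affine hs d _).ge
  · intro y hy hy1
    exact (dimH_preimage_affine hs d _).le.trans (h.dimH_level_le y hy hy1)

lemma exists_ratio {n u : ℝ} (hn : 1 < n) (hu : 0 < u) :
    ∃ l : ℝ, 0 < l ∧ n * l ^ u = 1 ∧ ∀ w, u < w → n * l ^ w < 1 := by
  have hn0 : 0 < n := by linarith
  refine ⟨n ^ (-u⁻¹), by positivity, ?_, fun w hw => ?_⟩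
  · rw [← Real.rpow_mul hn0.le, neg_mul, inv_mul_cancel₀ hu.ne', Real.rpow_neg_one,
      mul_inv_cancel₀ hn0.ne']
  · rw [← Real.rpow_mul hn0.le]
    nth_rewrite 1 [← Real.rpow_one n]
    rw [← Real.rpow_add hn0]
    apply Real.rpow_lt_one_of_one_lt_of_neg hn
    have : 1 < u⁻¹ * w := by rw [inv_mul_eq_div, one_lt_div hu]; exact hw
    linarith

lemma exists_isPiece {a b κ v t : ℝ} (ha : 0 < a) (hab : a ≤ b) (hb : b ≤ 1)
    (hκ : (0 ≤ κ ∧ κ < v ∧ v ≤ a) ∨ (κ = 0 ∧ v = 0 ∧ b = 1)) (ht : 0 ≤ t) (hta : t < a)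
    {δ p q : ℝ} (hδ : 0 < δ) (hpq : p < q) : ∃ ν C H, IsPiece a b κ v t δ p q ν C H := by
  suffices h : ∃ δ p q ν C H, 0 < δ ∧ p < q ∧ IsPiece a b κ v t δ p q ν C H by
    obtain ⟨δ', p', q', ν, C, H, h1, h2, h3⟩ := h
    exact h3.rescale h1 h2 hδ hpq
  rcases hκ with ⟨hκ0, hκv, hva⟩ | ⟨rfl, rfl, rfl⟩
  · set u := (κ + v) / 2
    have hκu : κ < u := by simp only [u]; linarith
    have huv : u < v := by simp only [u]; linarith
    have hu : 0 < u := hκ0.trans_lt hκu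
    have hθ : 0 < 1 - κ / u := by rw [sub_pos, div_lt_one hu]; exact hκu
    obtain ⟨N, hN1, hN2⟩ : ∃ N : ℕ, 1 < N ∧ (2 : ℝ) ≤ (2 * N : ℝ) ^ (1 - κ / u) := by
      have h1 : Tendsto (fun N : ℕ => (2 * N : ℝ) ^ (1 - κ / u)) atTop atTop :=
        (tendsto_rpow_atTop hθ).comp
          (tendsto_natCast_atTop_atTop.const_mul_atTop two_pos)
      exact ((eventually_gt_atTop 1).and (h1.eventually_ge_atTop 2)).exists
    have hN1' : (1 : ℝ) < N := by exact_mod_cast hN1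
    have hN0 : (0 : ℝ) < 2 * N := by linarith
    obtain ⟨l, hl, hlu, hlw⟩ := exists_ratio (n := 2 * N) (by linarith) hu
    have hl1 : 2 * N * l < 1 := by simpa using hlw 1 (by linarith)
    refine exists_isPiece_cantor hN1.le hl hl1 hu.le hlu (huv.trans_le hva) hab hb ht hta
      (fun σ => ?_) (fun h _ _ => ?_)
    · rcases hκ0.eq_or_lt with rfl | hκ0
      · simp
      refine le_dimH_cantorMap_fibre hN1 hl hl1 hκ0 ?_ σ
      have h1 : l ^ u = (2 * N : ℝ)⁻¹ := eq_inv_of_mul_eq_one_right hlu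
      have h2 : l ^ κ = ((2 * N : ℝ) ^ (κ / u))⁻¹ := by
        rw [← Real.inv_rpow hN0.le, ← h1, ← Real.rpow_mul hl.le]
        congr 1; field_simp
      rw [Real.rpow_sub hN0, Real.rpow_one, le_div_iff₀ (by positivity)] at hN2
      rw [h2, ← div_eq_mul_inv, le_div_iff₀ (by positivity)]
      linarith
    · exact (dimH_mono (image_subset_range _ _)).trans
        (dimH_range_cantorMap_le hN1.le hl hl1 (hu.trans huv) (hlw v huv))
  · obtain ⟨l, hl, hlu, hlw⟩ := exists_ratio (n := 2 * (1 : ℕ)) (u := a / 2) (by norm_num)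
      (by linarith)
    have hl1 : 2 * (1 : ℕ) * l < 1 := by simpa using hlw 1 (by linarith)
    refine exists_isPiece_cantor le_rfl hl hl1 (by linarith) hlu (by linarith) hab hb ht hta
      (fun σ => by simp) (fun h hh hh1 => ?_)
    have ha1 : a < 1 := hh.1.trans_lt hh1
    rw [ENNReal.ofReal_zero, nonpos_iff_eq_zero]
    refine Set.Countable.dimH_zero (Set.Countable.image ?_ _)
    have hinj : Function.Injective fun (x : ℕ → Fin 2 × Fin 1) k => (x k).1 := by
      intro x y hxy
      funext k
      exact Prod.ext (congrFun hxy k) (Subsingleton.elim _ _)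
    refine ((countable_ofDigits_fibre ((h - a) / (1 - a))).preimage hinj).mono fun x hx => ?_
    have hx' : a + (1 - a) * Real.ofDigits (fun k => (x k).1) = h := hx
    rw [mem_preimage, mem_ofPred_eq, eq_div_iff (by linarith)]
    linarith

lemma eventually_mul_rpow_le (K : ℝ) {s t : ℝ} (h : s < t) :
    ∀ᶠ r in 𝓝[>] (0 : ℝ), K * r ^ t ≤ r ^ s := by
  have h1 : Tendsto (fun r : ℝ => K * r ^ (t - s)) (𝓝[>] 0) (𝓝 (K * 0 ^ (t - s))) :=
    ((Real.continuousAt_rpow_const _ _ (Or.inr (by linarith))).tendsto.mono_left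
      nhdsWithin_le_nhds).const_mul K
  rw [Real.zero_rpow (by linarith), mul_zero] at h1
  filter_upwards [h1.eventually_lt_const one_pos, self_mem_nhdsWithin] with r hr hr0
  have hr0 : 0 < r := hr0
  have : r ^ t = r ^ (t - s) * r ^ s := by rw [← Real.rpow_add hr0]; congr 1; ring
  rw [this, ← mul_assoc]
  exact mul_le_of_le_one_left (by positivity) hr.le

lemma eventually_le_mul_rpow {c : ℝ} (hc : 0 < c) {s t : ℝ} (h : s < t) :
    ∀ᶠ r in 𝓝[>] (0 : ℝ), r ^ t ≤ c * r ^ s := by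
  filter_upwards [eventually_mul_rpow_le c⁻¹ h] with r hr
  rwa [inv_mul_le_iff₀ hc] at hr

lemma eventually_Ioo_zero {r : ℝ} (hr : 0 < r) : ∀ᶠ ρ in 𝓝[>] (0 : ℝ), ρ ∈ Ioo 0 r :=
  Ioo_mem_nhdsGT hr

lemma le_locDim {μ : Measure ℝ} {x T : ℝ} (hT : 0 < T)
    (h : ∀ t, 0 ≤ t → t < T → ∃ K : ℝ, ∀ r ∈ Ioo (0 : ℝ) 1, μ (ball x r) ≤ ENNReal.ofReal (K * r ^ t)) :
    (T : EReal) ≤ locDim μ x := by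
  unfold locDim
  split_ifs with hpos
  swap
  · exact le_top
  refine le_of_forall_lt fun c hc => ?_
  obtain ⟨t, hct, htT⟩ := EReal.lt_iff_exists_real_btwn.mp (max_lt hc (EReal.coe_pos.mpr hT))
  have ht0 : 0 ≤ t := EReal.coe_nonneg.mp ((le_max_right _ _).trans hct.le)
  refine ((le_max_left c 0).trans_lt hct).trans_le ?_
  obtain ⟨t', ht, ht'⟩ := exists_between (EReal.coe_lt_coe_iff.mp htT)
  obtain ⟨K, hK⟩ := h t' (ht0.trans ht.le) ht'
  refine le_liminf_of_le (by isBoundedDefault) ?_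
  filter_upwards [eventually_mul_rpow_le K ht, eventually_Ioo_zero one_pos] with r hr hr1
  rw [EReal.coe_le_coe_iff, le_div_iff_of_neg (Real.log_neg hr1.1 hr1.2)]
  have h1 := (hK r hr1).trans (ENNReal.ofReal_le_ofReal hr)
  have hm : 0 < (μ (ball x r)).toReal :=
    ENNReal.toReal_pos (hpos r hr1.1).ne' (h1.trans_lt ENNReal.ofReal_lt_top).ne
  rw [← Real.log_rpow hr1.1]
  exact Real.log_le_log hm (ENNReal.toReal_le_of_le_ofReal (Real.rpow_nonneg hr1.1.le _) h1)

lemma locDim_le {μ : Measure ℝ} [IsFiniteMeasure μ] {x T : ℝ}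
    (h : ∀ t, T < t → ∃ c > 0, ∃ r > 0, ∀ ρ ∈ Ioo (0 : ℝ) r,
      ENNReal.ofReal (c * ρ ^ t) ≤ μ (ball x ρ)) :
    locDim μ x ≤ (T : EReal) := by
  have hpos : ∀ r : ℝ, 0 < r → 0 < μ (ball x r) := by
    intro r hr
    obtain ⟨c, hc, r', hr', hb⟩ := h (T + 1) (by linarith)
    obtain ⟨ρ, hρ0, hρ⟩ := exists_between (lt_min hr hr')
    refine lt_of_lt_of_le ?_ ((hb ρ ⟨hρ0, hρ.trans_le (min_le_right _ _)⟩).trans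
      (measure_mono (ball_subset_ball (hρ.le.trans (min_le_left _ _)))))
    exact ENNReal.ofReal_pos.mpr (by positivity)
  unfold locDim
  rw [if_pos hpos]
  refine le_of_forall_gt fun c hc => ?_
  obtain ⟨t, htT, htc⟩ := EReal.lt_iff_exists_real_btwn.mp hc
  refine lt_of_le_of_lt ?_ htc
  obtain ⟨t', ht', ht⟩ := exists_between (EReal.coe_lt_coe_iff.mp htT)
  obtain ⟨c, hc, r, hr, hb⟩ := h t' ht'
  refine le_trans liminf_le_limsup (limsup_le_of_le (by isBoundedDefault) ?_)
  filter_upwards [eventually_le_mul_rpow hc ht, eventually_Ioo_zero one_pos,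
    eventually_Ioo_zero hr] with ρ h1 hρ1 hρr
  rw [EReal.coe_le_coe_iff, div_le_iff_of_neg (Real.log_neg hρ1.1 hρ1.2), ← Real.log_rpow hρ1.1]
  refine Real.log_le_log (Real.rpow_pos_of_pos hρ1.1 _) ?_
  exact (ENNReal.ofReal_le_iff_le_toReal (measure_ne_top _ _)).mp
    ((ENNReal.ofReal_le_ofReal h1).trans (hb ρ hρr))

/-- A countable sum of measures satisfies a power bound on the balls around `x` as soon as each of
them does and almost all of them do with summable constants. -/
lemma sum_ball_le {ν : ℕ → Measure ℝ} {x t : ℝ} {J : ℕ}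
    (h1 : ∀ j < J, ∃ K : ℝ, ∀ r ∈ Ioo (0 : ℝ) 1, ν j (ball x r) ≤ ENNReal.ofReal (K * r ^ t))
    (h2 : ∀ j ≥ J, ∀ r ∈ Ioo (0 : ℝ) 1, ν j (ball x r) ≤ ENNReal.ofReal ((1 / 2) ^ j * r ^ t)) :
    ∃ K : ℝ, ∀ r ∈ Ioo (0 : ℝ) 1, Measure.sum ν (ball x r) ≤ ENNReal.ofReal (K * r ^ t) := by
  have h : ∀ j, ∃ K : ℝ, 0 ≤ K ∧ (J ≤ j → K = (1 / 2) ^ j) ∧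
      ∀ r ∈ Ioo (0 : ℝ) 1, ν j (ball x r) ≤ ENNReal.ofReal (K * r ^ t) := by
    intro j
    rcases lt_or_ge j J with hj | hj
    · obtain ⟨K, hK⟩ := h1 j hj
      refine ⟨max K 0, le_max_right _ _, fun h => absurd hj (not_lt.mpr h), fun r hr => ?_⟩
      refine (hK r hr).trans (ENNReal.ofReal_le_ofReal ?_)
      exact mul_le_mul_of_nonneg_right (le_max_left _ _) (Real.rpow_nonneg hr.1.le _)
    · exact ⟨_, by positivity, fun _ => rfl, h2 j hj⟩
  choose K hK0 hKJ hK using h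
  have hsum : Summable K := by
    rw [← summable_nat_add_iff J]
    refine ((summable_nat_add_iff J).mpr (summable_geometric_two)).congr fun j => ?_
    exact (hKJ (j + J) (by omega)).symm
  refine ⟨∑' j, K j, fun r hr => ?_⟩
  rw [Measure.sum_apply _ measurableSet_ball, ← tsum_mul_right,
    ENNReal.ofReal_tsum_of_nonneg (fun j => mul_nonneg (hK0 j) (Real.rpow_nonneg hr.1.le _))
      (hsum.mul_right _)]
  exact ENNReal.tsum_le_tsum fun j => hK j r hr

lemma exists_seq_avoiding {α : Type*} (Q : ℕ → Set ℝ → α → Prop) (C : α → Set ℝ)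
    (h : ∀ j A, IsClosed A → volume A = 0 → ∃ d, Q j A d ∧ IsClosed (C d) ∧ volume (C d) = 0) :
    ∃ d : ℕ → α, ∀ j, ∃ A, Q j A (d j) ∧ ∀ i < j, C (d i) ⊆ A := by
  have : Nonempty α := ⟨(h 0 ∅ isClosed_empty measure_empty).choose⟩
  choose! F hQ hF hF0 using h
  let A : ℕ → Set ℝ := fun j => Nat.rec ∅ (fun j A => A ∪ C (F j A)) j
  have hsucc : ∀ j, A (j + 1) = A j ∪ C (F j (A j)) := fun j => rfl
  have hA : ∀ j, IsClosed (A j) ∧ volume (A j) = 0 := by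
    intro j
    induction j with
    | zero => exact ⟨isClosed_empty, measure_empty⟩
    | succ j ih =>
      rw [hsucc]
      exact ⟨ih.1.union (hF j _ ih.1 ih.2), measure_union_null ih.2 (hF0 j _ ih.1 ih.2)⟩
  have hmono : Monotone A := monotone_nat_of_le_succ fun j => subset_union_left
  refine ⟨fun j => F j (A j), fun j => ⟨A j, hQ j _ (hA j).1 (hA j).2, fun i hi => ?_⟩⟩
  exact (subset_union_right.trans (hsucc i).ge).trans (hmono hi)

/-- The interval with the same centre as `(p, q)` and three times its length. -/
def window (p q : ℝ) : Set ℝ := Ioo (p - (q - p)) (q + (q - p))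

lemma Ioo_subset_window {p q : ℝ} (h : p < q) : Ioo p q ⊆ window p q :=
  Ioo_subset_Ioo (by linarith) (by linarith)

lemma exists_window {A : Set ℝ} (hA : IsClosed A) (hA0 : volume A = 0) {α β ε : ℝ} (h : α < β)
    (hε : 0 < ε) : ∃ p q, p < q ∧ 3 * (q - p) ≤ ε ∧ window p q ⊆ Ioo α β ∧
      Disjoint (window p q) A := by
  have hne : (Ioo α β \ A).Nonempty := by
    apply nonempty_of_measure_ne_zero (μ := volume)
    rw [measure_sdiff_null hA0]
    simpa using h
  obtain ⟨x, hx⟩ := hne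
  obtain ⟨r, hr, hsub⟩ := Metric.isOpen_iff.mp (isOpen_Ioo.sdiff hA) x hx
  obtain ⟨e, he0, he⟩ := exists_between (lt_min hr (half_pos hε))
  have hw : window (x - e / 3) (x + e / 3) ⊆ Ioo α β \ A := by
    refine subset_trans ?_ hsub
    rw [Real.ball_eq_Ioo]
    have := he.le.trans (min_le_left _ _)
    exact Ioo_subset_Ioo (by linarith) (by linarith)
  refine ⟨x - e / 3, x + e / 3, by linarith, ?_, fun y hy => (hw hy).1,
    disjoint_left.mpr fun y hy => (hw hy).2⟩
  have := he.le.trans (min_le_right _ _)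
  linarith

/-- A sequence of pieces whose enlarged intervals avoid the singular sets of the previous pieces. -/
structure IsArrangement (s : ℝ) (a b κ v p q : ℕ → ℝ) (ν : ℕ → Measure ℝ) (C : ℕ → Set ℝ)
    (H : ℕ → ℝ → ℝ) : Prop where
  piece : ∀ j, IsPiece (a j) (b j) (κ j) (v j) (a j * (j / (j + 1)))
    ((1 / 2) ^ j * min 1 (q j - p j)) (p j) (q j) (ν j) (C j) (H j)
  lt : ∀ j, p j < q j
  length_le : ∀ j, 3 * (q j - p j) ≤ (1 / 2) ^ j
  window_subset : ∀ j, window (p j) (q j) ⊆ Ioo 0 1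
  disjoint : ∀ i j, i < j → Disjoint (window (p j) (q j)) (C i)
  pos : 0 < s
  le_one : s ≤ 1
  le_left : ∀ j, s ≤ a j
  right_le : ∀ j, b j ≤ 1

/-- The sum of the Lebesgue measure on `[0, 1]` and of countably many measures. -/
noncomputable def lebesgueAddSum (ν : ℕ → Measure ℝ) : Measure ℝ :=
  volume.restrict (Icc 0 1) + Measure.sum ν

/-- The measure `lebesgueAddSum ν`, normalised to a probability measure. -/
noncomputable def normalizedSum (ν : ℕ → Measure ℝ) : Measure ℝ :=
  (lebesgueAddSum ν univ)⁻¹ • lebesgueAddSum ν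

/-- The points lying in infinitely many windows. -/
def recurrentSet (p q : ℕ → ℝ) : Set ℝ := {x | ∃ᶠ j in atTop, x ∈ window (p j) (q j)}

lemma one_le_lebesgueAddSum_univ (ν : ℕ → Measure ℝ) : 1 ≤ lebesgueAddSum ν univ := by
  simp [lebesgueAddSum]

lemma normalizedSum_le (ν : ℕ → Measure ℝ) (S : Set ℝ) :
    normalizedSum ν S ≤ lebesgueAddSum ν S := by
  rw [normalizedSum, Measure.smul_apply, smul_eq_mul]
  exact mul_le_of_le_one_left' (ENNReal.inv_le_one.mpr (one_le_lebesgueAddSum_univ ν))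

namespace IsArrangement

variable {s : ℝ} {a b κ v p q : ℕ → ℝ} {ν : ℕ → Measure ℝ} {C : ℕ → Set ℝ} {H : ℕ → ℝ → ℝ}

lemma singular_subset_window (h : IsArrangement s a b κ v p q ν C H) (j : ℕ) :
    C j ⊆ window (p j) (q j) :=
  (h.piece j).subset_Ioo.trans (Ioo_subset_window (h.lt j))

lemma notMem_window (h : IsArrangement s a b κ v p q ν C H) {x : ℝ} {i j : ℕ} (hij : i < j)
    (hx : x ∈ C i) : x ∉ window (p j) (q j) :=
  fun hw => disjoint_left.mp (h.disjoint i j hij) hw hx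

lemma measure_univ_le (h : IsArrangement s a b κ v p q ν C H) (j : ℕ) :
    ν j univ ≤ ENNReal.ofReal ((1 / 2) ^ j) := by
  refine (h.piece j).measure_univ_le.trans (ENNReal.ofReal_le_ofReal ?_)
  exact mul_le_of_le_one_right (by positivity) (min_le_left _ _)

lemma lebesgueAddSum_univ_ne_top (h : IsArrangement s a b κ v p q ν C H) :
    lebesgueAddSum ν univ ≠ ⊤ := by
  have h1 : ∑' j, ν j univ ≤ ENNReal.ofReal (∑' j, (1 / 2) ^ j) := by
    rw [ENNReal.ofReal_tsum_of_nonneg (fun j => by positivity) summable_geometric_two]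
    exact ENNReal.tsum_le_tsum h.measure_univ_le
  simpa [lebesgueAddSum] using (h1.trans_lt ENNReal.ofReal_lt_top).ne

lemma isProbabilityMeasure (h : IsArrangement s a b κ v p q ν C H) :
    IsProbabilityMeasure (normalizedSum ν) := by
  constructor
  rw [normalizedSum, Measure.smul_apply, smul_eq_mul, ENNReal.inv_mul_cancel _
    h.lebesgueAddSum_univ_ne_top]
  exact (zero_lt_one.trans_le (one_le_lebesgueAddSum_univ ν)).ne'

lemma measure_compl_Icc (h : IsArrangement s a b κ v p q ν C H) :
    normalizedSum ν (Icc 0 1)ᶜ = 0 := by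
  refine le_antisymm ((normalizedSum_le _ _).trans ?_) zero_le
  rw [lebesgueAddSum, Measure.add_apply, Measure.restrict_apply measurableSet_Icc.compl,
    compl_inter_self, measure_empty, zero_add, Measure.sum_apply _ measurableSet_Icc.compl]
  simp only [nonpos_iff_eq_zero, ENNReal.tsum_eq_zero]
  intro j
  refine measure_mono_null (compl_subset_compl.mpr ?_) (h.piece j).measure_compl
  exact ((Ioo_subset_window (h.lt j)).trans (h.window_subset j)).trans Ioo_subset_Icc_self

lemma exists_le_normalizedSum (h : IsArrangement s a b κ v p q ν C H) :
    ∃ c : ℝ, 0 < c ∧ ∀ S, ENNReal.ofReal c * lebesgueAddSum ν S ≤ normalizedSum ν S := by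
  have h1 := h.lebesgueAddSum_univ_ne_top
  have h0 : lebesgueAddSum ν univ ≠ 0 :=
    (zero_lt_one.trans_le (one_le_lebesgueAddSum_univ ν)).ne'
  refine ⟨(lebesgueAddSum ν univ).toReal⁻¹, inv_pos.mpr (ENNReal.toReal_pos h0 h1), fun S => ?_⟩
  rw [normalizedSum, Measure.smul_apply, smul_eq_mul, ← ENNReal.toReal_inv,
    ENNReal.ofReal_toReal (ENNReal.inv_ne_top.mpr h0)]

lemma ball_le_of_notMem_window (h : IsArrangement s a b κ v p q ν C H) {x r : ℝ} {j : ℕ}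
    (hx : x ∉ window (p j) (q j)) :
    ν j (ball x r) ≤ ENNReal.ofReal ((1 / 2) ^ j * r) := by
  rcases le_or_gt r (q j - p j) with hle | hlt
  · refine le_trans (le_of_eq ?_) zero_le
    refine measure_mono_null (t := (Ioo (p j) (q j))ᶜ) (fun y hy hy' => hx ?_)
      (h.piece j).measure_compl
    rw [Real.ball_eq_Ioo] at hy
    exact ⟨by linarith [hy.2, hy'.1], by linarith [hy.1, hy'.2]⟩
  · refine ((measure_mono (subset_univ _)).trans (h.piece j).measure_univ_le).trans
      (ENNReal.ofReal_le_ofReal ?_)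
    gcongr
    exact (min_le_right _ _).trans hlt.le

lemma ball_le_rpow_of_notMem_window (h : IsArrangement s a b κ v p q ν C H) {x r t : ℝ} {j : ℕ}
    (hx : x ∉ window (p j) (q j)) (ht : t ≤ 1) (hr : r ∈ Ioo (0 : ℝ) 1) :
    ν j (ball x r) ≤ ENNReal.ofReal ((1 / 2) ^ j * r ^ t) := by
  refine (h.ball_le_of_notMem_window hx).trans ?_
  simpa using rpow_le_of_small (K := (1 / 2) ^ j) (by positivity) hr.1 hr.2.le ht

lemma exists_ball_le_rpow_of_notMem (h : IsArrangement s a b κ v p q ν C H) {x t : ℝ} {j : ℕ}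
    (hx : x ∉ C j) (ht : t ≤ 1) :
    ∃ K : ℝ, ∀ r ∈ Ioo (0 : ℝ) 1, ν j (ball x r) ≤ ENNReal.ofReal (K * r ^ t) := by
  obtain ⟨K, hK⟩ := (h.piece j).ball_le_of_notMem x hx
  refine ⟨max K 0, fun r hr => (hK r hr.1).trans ?_⟩
  calc ENNReal.ofReal (K * r) ≤ ENNReal.ofReal (max K 0 * r ^ (1 : ℝ)) := by
        rw [Real.rpow_one]
        have := hr.1.le
        gcongr
        exact le_max_left _ _
    _ ≤ _ := rpow_le_of_small (le_max_right _ _) hr.1 hr.2.le ht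

lemma exists_ball_le_rpow (h : IsArrangement s a b κ v p q ν C H) (j : ℕ) {x t : ℝ}
    (hxt : x ∈ C j → 0 ≤ t ∧ t < H j x) (ht : t ≤ 1) :
    ∃ K : ℝ, ∀ r ∈ Ioo (0 : ℝ) 1, ν j (ball x r) ≤ ENNReal.ofReal (K * r ^ t) := by
  by_cases hx : x ∈ C j
  · obtain ⟨K, hK⟩ := (h.piece j).ball_le_of_lt x hx t (hxt hx).1 (hxt hx).2
    exact ⟨K, fun r hr => hK r hr.1⟩
  · exact h.exists_ball_le_rpow_of_notMem hx ht

lemma le_locDim (h : IsArrangement s a b κ v p q ν C H) {x T : ℝ} (hT : 0 < T) (hT1 : T ≤ 1)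
    (hC : ∀ j, x ∈ C j → T ≤ H j x)
    (hJ : ∀ t, 0 ≤ t → t < T → ∃ J, ∀ j ≥ J, ∀ r ∈ Ioo (0 : ℝ) 1,
      ν j (ball x r) ≤ ENNReal.ofReal ((1 / 2) ^ j * r ^ t)) :
    (T : EReal) ≤ locDim (normalizedSum ν) x := by
  refine _root_.le_locDim hT fun t ht htT => ?_
  obtain ⟨J, hJ⟩ := hJ t ht htT
  have ht1 : t ≤ 1 := htT.le.trans hT1
  obtain ⟨K, hK⟩ := sum_ball_le (J := J)
    (fun j _ => h.exists_ball_le_rpow j (fun hx => ⟨ht, htT.trans_le (hC j hx)⟩) ht1) hJ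
  refine ⟨2 + max K 0, fun r hr => (normalizedSum_le _ _).trans ?_⟩
  have hrt : 0 ≤ r ^ t := Real.rpow_nonneg hr.1.le _
  rw [lebesgueAddSum, Measure.add_apply, add_mul,
    ENNReal.ofReal_add (by positivity) (mul_nonneg (le_max_right _ _) hrt)]
  refine add_le_add ?_ ((hK r hr).trans (ENNReal.ofReal_le_ofReal ?_))
  · refine (Measure.restrict_apply_le _ _).trans ?_
    rw [Real.volume_ball]
    simpa using rpow_le_of_small (K := 2) two_pos.le hr.1 hr.2.le ht1
  · gcongr
    exact le_max_left _ _

lemma left_le_locDim (h : IsArrangement s a b κ v p q ν C H) (x : ℝ) :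
    (s : EReal) ≤ locDim (normalizedSum ν) x := by
  refine h.le_locDim h.pos h.le_one
    (fun j hx => (h.le_left j).trans ((h.piece j).mem_Icc x hx).1) fun t _ hts => ?_
  have hlim : Tendsto (fun j : ℕ => s * ((j : ℝ) / (j + 1))) atTop (𝓝 (s * 1)) :=
    (tendsto_natCast_div_add_atTop (1 : ℝ)).const_mul s
  rw [mul_one] at hlim
  obtain ⟨J, hJ⟩ := eventually_atTop.mp (hlim.eventually_const_lt hts)
  refine ⟨J, fun j hj r hr => ((h.piece j).ball_le x r hr.1).trans ?_⟩
  have hr0 := hr.1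
  have hmin : 0 ≤ min 1 (q j - p j) := le_min zero_le_one (by linarith [h.lt j])
  calc _ ≤ ENNReal.ofReal ((1 / 2) ^ j * r ^ (a j * ((j : ℝ) / (j + 1)))) := by
        apply ENNReal.ofReal_le_ofReal
        gcongr
        exact mul_le_of_le_one_right (by positivity) (min_le_left _ _)
    _ ≤ _ := by
        refine rpow_le_of_small (by positivity) hr.1 hr.2.le ((hJ j hj).le.trans ?_)
        exact mul_le_mul_of_nonneg_right (h.le_left j) (by positivity)

lemma locDim_le_one (h : IsArrangement s a b κ v p q ν C H) {x : ℝ} (hx : x ∈ Icc (0 : ℝ) 1) :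
    locDim (normalizedSum ν) x ≤ 1 := by
  have := h.isProbabilityMeasure
  refine _root_.locDim_le (T := 1) fun t ht => ?_
  obtain ⟨c, hc, hcS⟩ := h.exists_le_normalizedSum
  refine ⟨c, hc, 1 / 2, by norm_num, fun ρ hρ => le_trans ?_ (hcS _)⟩
  rw [ENNReal.ofReal_mul hc.le]
  gcongr
  have h1 : ENNReal.ofReal (ρ ^ t) ≤ ENNReal.ofReal ρ := by
    simpa using rpow_le_of_small (K := 1) zero_le_one hρ.1 (by linarith [hρ.2]) ht.le
  refine h1.trans ((?_ : _ ≤ volume.restrict (Icc (0 : ℝ) 1) (ball x ρ)).trans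
    (Measure.le_add_right le_rfl _))
  rw [Measure.restrict_apply measurableSet_ball, Real.ball_eq_Ioo]
  rcases le_total x (1 / 2) with h2 | h2
  · refine le_trans ?_ (measure_mono (s := Ioo x (x + ρ)) fun y hy =>
      ⟨⟨by linarith [hy.1, hρ.1], hy.2⟩, by linarith [hx.1, hy.1], by linarith [hy.2, hρ.2]⟩)
    rw [Real.volume_Ioo]; simp
  · refine le_trans ?_ (measure_mono (s := Ioo (x - ρ) x) fun y hy =>
      ⟨⟨hy.1, by linarith [hy.2, hρ.1]⟩, by linarith [hρ.2, hy.1], by linarith [hy.2, hx.2]⟩)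
    rw [Real.volume_Ioo]; simp

lemma locDim_eq_one (h : IsArrangement s a b κ v p q ν C H) {x : ℝ} (hx : x ∈ Icc (0 : ℝ) 1)
    (hC : ∀ j, x ∉ C j) (hZ : x ∉ recurrentSet p q) : locDim (normalizedSum ν) x = 1 := by
  refine le_antisymm (h.locDim_le_one hx) ?_
  refine h.le_locDim one_pos le_rfl (fun j hj => absurd hj (hC j)) fun t _ ht => ?_
  obtain ⟨J, hJ⟩ := eventually_atTop.mp (not_frequently.mp hZ)
  exact ⟨J, fun j hj r hr => h.ball_le_rpow_of_notMem_window (hJ j hj) ht.le hr⟩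

lemma locDim_of_mem (h : IsArrangement s a b κ v p q ν C H) {x : ℝ} {j : ℕ} (hx : x ∈ C j) :
    locDim (normalizedSum ν) x = (H j x : EReal) := by
  have := h.isProbabilityMeasure
  have hH := (h.piece j).mem_Icc x hx
  have hH1 : H j x ≤ 1 := hH.2.trans (h.right_le j)
  refine le_antisymm ?_ ?_
  · refine _root_.locDim_le fun t ht => ?_
    obtain ⟨c, hc, hcS⟩ := h.exists_le_normalizedSum
    obtain ⟨c', hc', r, hr, hle⟩ := (h.piece j).le_ball x hx t ht
    refine ⟨c * c', by positivity, r, hr, fun ρ hρ => le_trans ?_ (hcS _)⟩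
    rw [mul_assoc, ENNReal.ofReal_mul hc.le]
    gcongr
    exact (hle ρ hρ).trans ((Measure.le_sum ν j _).trans (Measure.le_add_left le_rfl _))
  · refine h.le_locDim (h.pos.trans_le ((h.le_left j).trans hH.1)) hH1 (fun i hi => ?_)
      fun t _ ht => ⟨j + 1, fun i hi r hr =>
        h.ball_le_rpow_of_notMem_window (h.notMem_window hi hx) (ht.le.trans hH1) hr⟩
    rcases lt_trichotomy i j with hij | rfl | hij
    · exact absurd (h.singular_subset_window j hx) (h.notMem_window hij hi)
    · exact le_rfl
    · exact absurd (h.singular_subset_window i hi) (h.notMem_window hij hx)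

lemma hausdorffMeasure_recurrentSet (h : IsArrangement s a b κ v p q ν C H) {d : ℝ} (hd : 0 < d) :
    μH[d] (recurrentSet p q) = 0 := by
  set w : ℝ := (1 / 2) ^ d
  have hw0 : 0 < w := by positivity
  have hw1 : w < 1 := Real.rpow_lt_one (by norm_num) (by norm_num) hd
  have hdiam : ∀ j, ediam (window (p j) (q j)) ≤ ENNReal.ofReal ((1 / 2) ^ j) := fun j => by
    rw [window, Real.ediam_Ioo]
    exact ENNReal.ofReal_le_ofReal (by linarith [h.length_le j])
  have hlim : Tendsto (fun n : ℕ => ENNReal.ofReal ((1 / 2 : ℝ) ^ n)) atTop (𝓝 0) := by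
    rw [← ENNReal.ofReal_zero]
    exact ENNReal.tendsto_ofReal (tendsto_pow_atTop_nhds_zero_of_lt_one (by norm_num) (by norm_num))
  have hle := Measure.hausdorffMeasure_le_liminf_tsum d (recurrentSet p q) (l := atTop) _ hlim
    (fun n (i : ℕ) => window (p (i + n)) (q (i + n)))
    (Eventually.of_forall fun n i => (hdiam (i + n)).trans (ENNReal.ofReal_le_ofReal
      (pow_le_pow_of_le_one (by norm_num) (by norm_num) (by omega))))
    (Eventually.of_forall fun n x hx => by
      obtain ⟨j, hj, hxj⟩ := (frequently_atTop.mp hx) n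
      exact mem_iUnion.mpr ⟨j - n, by rwa [Nat.sub_add_cancel hj]⟩)
  refine le_antisymm (hle.trans ?_) zero_le
  have hbound : Tendsto (fun n : ℕ => ENNReal.ofReal (w ^ n * (1 - w)⁻¹)) atTop (𝓝 0) := by
    rw [← ENNReal.ofReal_zero, ← zero_mul (1 - w)⁻¹]
    exact ENNReal.tendsto_ofReal
      ((tendsto_pow_atTop_nhds_zero_of_lt_one hw0.le hw1).mul_const _)
  refine (liminf_le_liminf (Eventually.of_forall fun n => ?_)).trans hbound.liminf_eq.le
  calc ∑' i : ℕ, ediam (window (p (i + n)) (q (i + n))) ^ d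
      ≤ ∑' i : ℕ, ENNReal.ofReal (w ^ n * w ^ i) := by
        refine ENNReal.tsum_le_tsum fun i => ?_
        refine (ENNReal.rpow_le_rpow (hdiam _) hd.le).trans (le_of_eq ?_)
        rw [ENNReal.ofReal_rpow_of_pos (by positivity)]
        congr 1
        rw [← pow_add, add_comm n i, ← Real.rpow_natCast, ← Real.rpow_natCast w, ← Real.rpow_mul
          (by norm_num), ← Real.rpow_mul (by norm_num), mul_comm]
    _ = _ := by
        rw [← ENNReal.ofReal_tsum_of_nonneg (fun i => by positivity)
          ((summable_geometric_of_lt_one hw0.le hw1).mul_left _), tsum_mul_left,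
          tsum_geometric_of_lt_one hw0.le hw1]

lemma dimH_recurrentSet (h : IsArrangement s a b κ v p q ν C H) : dimH (recurrentSet p q) = 0 := by
  refine le_antisymm (le_of_forall_gt fun c hc => ?_) zero_le
  obtain ⟨d, hd0, hdc⟩ := ENNReal.lt_iff_exists_nnreal_btwn.mp hc
  refine lt_of_le_of_lt (dimH_le_of_hausdorffMeasure_ne_top ?_) hdc
  rw [h.hausdorffMeasure_recurrentSet (by exact_mod_cast hd0)]
  exact ENNReal.zero_ne_top

lemma volume_locDim_ne_one (h : IsArrangement s a b κ v p q ν C H) :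
    volume {x ∈ Icc (0 : ℝ) 1 | locDim (normalizedSum ν) x ≠ 1} = 0 := by
  have hZ : volume (recurrentSet p q) = 0 := by
    rw [← hausdorffMeasure_real]
    exact h.hausdorffMeasure_recurrentSet one_pos
  refine measure_mono_null (t := recurrentSet p q ∪ ⋃ j, C j) (fun x hx => ?_)
    (measure_union_null hZ (measure_iUnion_null fun j => (h.piece j).volume_eq_zero))
  by_contra hcon
  simp only [mem_union, mem_iUnion, not_or, not_exists] at hcon
  exact hx.2 (h.locDim_eq_one hx.1 hcon.2 hcon.1)

lemma level_subset (h : IsArrangement s a b κ v p q ν C H) {h' : ℝ} {j : ℕ} {B : Set ℝ}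
    (hB : window (p j) (q j) ⊆ B) :
    C j ∩ H j ⁻¹' {h'} ⊆ {x ∈ B | locDim (normalizedSum ν) x = h'} := by
  rintro x ⟨hx, rfl⟩
  exact ⟨hB (h.singular_subset_window j hx), h.locDim_of_mem hx⟩

lemma dimH_level_le (h : IsArrangement s a b κ v p q ν C H) {h' : ℝ} (hh : h' < 1) {D : ℝ≥0∞}
    (hD : ∀ j, h' ∈ Icc (a j) (b j) → ENNReal.ofReal (v j) ≤ D) :
    dimH {x ∈ Icc (0 : ℝ) 1 | locDim (normalizedSum ν) x = h'} ≤ D := by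
  have hsub : {x ∈ Icc (0 : ℝ) 1 | locDim (normalizedSum ν) x = h'} ⊆
      recurrentSet p q ∪ ⋃ j, C j ∩ H j ⁻¹' {h'} := by
    intro x hx
    by_contra hcon
    simp only [mem_union, mem_iUnion, not_or, not_exists] at hcon
    have hC : ∀ j, x ∉ C j := fun j hj => hcon.2 j
      ⟨hj, EReal.coe_injective ((h.locDim_of_mem hj).symm.trans hx.2)⟩
    have h1 := (h.locDim_eq_one hx.1 hC hcon.1).symm.trans hx.2
    exact hh.ne' (EReal.coe_injective h1)
  refine (dimH_mono hsub).trans ?_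
  rw [dimH_union, dimH_iUnion, h.dimH_recurrentSet]
  refine max_le zero_le (iSup_le fun j => ?_)
  by_cases hj : h' ∈ Icc (a j) (b j)
  · exact ((h.piece j).dimH_level_le h' hj hh).trans (hD j hj)
  · have : C j ∩ H j ⁻¹' {h'} = ∅ := by
      refine eq_empty_of_forall_notMem ?_
      rintro x ⟨hx, rfl⟩
      exact hj ((h.piece j).mem_Icc x hx)
    simp [this]

end IsArrangement

lemma exists_arrangement {ι : Type*} [Countable ι] [Nonempty ι] {s : ℝ} {a b κ v : ι → ℝ}
    (hs : 0 < s) (hs1 : s ≤ 1) (hsa : ∀ i, s ≤ a i) (hab : ∀ i, a i ≤ b i) (hb : ∀ i, b i ≤ 1)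
    (hκ : ∀ i, (0 ≤ κ i ∧ κ i < v i ∧ v i ≤ a i) ∨ (κ i = 0 ∧ v i = 0 ∧ b i = 1)) :
    ∃ (i : ℕ → ι) (p q : ℕ → ℝ) (ν : ℕ → Measure ℝ) (C : ℕ → Set ℝ) (H : ℕ → ℝ → ℝ),
      IsArrangement s (a ∘ i) (b ∘ i) (κ ∘ i) (v ∘ i) p q ν C H ∧
      ∀ k α β, 0 ≤ α → α < β → β ≤ 1 → ∃ j, i j = k ∧ window (p j) (q j) ⊆ Ioo α β := by
  obtain ⟨e, he⟩ := exists_surjective_nat (ι × ℚ × ℚ)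
  let good : ℕ → Prop := fun j => 0 ≤ (e j).2.1 ∧ (e j).2.1 < (e j).2.2 ∧ (e j).2.2 ≤ 1
  let l : ℕ → ℝ := fun j => if good j then (e j).2.1 else 0
  let u : ℕ → ℝ := fun j => if good j then (e j).2.2 else 1
  have hl : ∀ j, 0 ≤ l j ∧ l j < u j ∧ u j ≤ 1 := by
    intro j
    by_cases hg : good j
    · simp only [l, u, if_pos hg]
      exact_mod_cast hg
    · simp [l, u, if_neg hg]
  obtain ⟨d, hd⟩ := exists_seq_avoiding
    (α := ℝ × ℝ × Measure ℝ × Set ℝ × (ℝ → ℝ))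
    (fun j A d => d.1 < d.2.1 ∧ 3 * (d.2.1 - d.1) ≤ (1 / 2) ^ j ∧
      window d.1 d.2.1 ⊆ Ioo (l j) (u j) ∧ Disjoint (window d.1 d.2.1) A ∧
      IsPiece (a (e j).1) (b (e j).1) (κ (e j).1) (v (e j).1) (a (e j).1 * (j / (j + 1)))
        ((1 / 2) ^ j * min 1 (d.2.1 - d.1)) d.1 d.2.1 d.2.2.1 d.2.2.2.1 d.2.2.2.2)
    (fun d => d.2.2.2.1) (by
      intro j A hA hA0
      obtain ⟨p, q, hpq, hlen, hw, hdisj⟩ := exists_window hA hA0 (hl j).2.1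
        (by positivity : (0 : ℝ) < (1 / 2) ^ j)
      have ha : 0 < a (e j).1 := hs.trans_le (hsa _)
      have hpos : 0 < q - p := sub_pos.mpr hpq
      obtain ⟨ν, C, H, hP⟩ := exists_isPiece ha (hab _) (hb _) (hκ (e j).1)
        (t := a (e j).1 * (j / (j + 1))) (δ := (1 / 2) ^ j * min 1 (q - p)) (by positivity)
        (mul_lt_of_lt_one_right ha ((div_lt_one (by positivity)).mpr (lt_add_one _)))
        (by positivity) hpq
      exact ⟨(p, q, ν, C, H), ⟨hpq, hlen, hw, hdisj, hP⟩, hP.isClosed, hP.volume_eq_zero⟩)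
  choose A hA hsub using hd
  refine ⟨fun j => (e j).1, fun j => (d j).1, fun j => (d j).2.1, fun j => (d j).2.2.1,
    fun j => (d j).2.2.2.1, fun j => (d j).2.2.2.2, ⟨fun j => (hA j).2.2.2.2, fun j => (hA j).1,
    fun j => (hA j).2.1, fun j => (hA j).2.2.1.trans (Ioo_subset_Ioo (hl j).1 (hl j).2.2),
    fun i j hij => (hA j).2.2.2.1.mono_right (hsub j i hij), hs, hs1, fun j => hsa _,
    fun j => hb _⟩, ?_⟩
  intro k α β hα hαβ hβ
  obtain ⟨r₁, h₁, h₁'⟩ := exists_rat_btwn hαβ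
  obtain ⟨r₂, h₂, h₂'⟩ := exists_rat_btwn h₁'
  obtain ⟨j, hj⟩ := he (k, r₁, r₂)
  have hg : good j := by
    simp only [good, hj]
    exact ⟨by exact_mod_cast (hα.trans_lt h₁).le, by exact_mod_cast h₂,
      by exact_mod_cast (h₂'.trans_le hβ).le⟩
  refine ⟨j, congrArg Prod.fst hj, (hA j).2.2.1.trans ?_⟩
  simp only [l, u, if_pos hg, hj]
  exact Ioo_subset_Ioo h₁.le h₂'.le

/-- A measure whose level sets of the local dimension are prescribed by the data `a b κ v`. -/
lemma exists_measure_levels {ι : Type*} [Countable ι] [Nonempty ι] {s : ℝ} {a b κ v : ι → ℝ}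
    (hs : 0 < s) (hs1 : s ≤ 1) (hsa : ∀ i, s ≤ a i) (hab : ∀ i, a i ≤ b i) (hb : ∀ i, b i ≤ 1)
    (hκ : ∀ i, (0 ≤ κ i ∧ κ i < v i ∧ v i ≤ a i) ∨ (κ i = 0 ∧ v i = 0 ∧ b i = 1)) :
    ∃ μ : Measure ℝ, IsProbabilityMeasure μ ∧ μ (Icc 0 1)ᶜ = 0 ∧
      (∀ x ∈ Icc (0 : ℝ) 1, (s : EReal) ≤ locDim μ x ∧ locDim μ x ≤ 1) ∧
      volume {x ∈ Icc (0 : ℝ) 1 | locDim μ x ≠ 1} = 0 ∧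
      (∀ i, ∀ h ∈ Icc (a i) (b i), ∀ α β : ℝ, 0 ≤ α → α < β → β ≤ 1 →
        {x ∈ Ioo α β | locDim μ x = h}.Nonempty ∧
        ENNReal.ofReal (κ i) ≤ dimH {x ∈ Ioo α β | locDim μ x = h}) ∧
      (∀ h : ℝ, h < 1 → ∀ D : ℝ≥0∞, (∀ i, h ∈ Icc (a i) (b i) → ENNReal.ofReal (v i) ≤ D) →
        dimH {x ∈ Icc (0 : ℝ) 1 | locDim μ x = h} ≤ D) := by
  obtain ⟨i, p, q, ν, C, H, hA, hdense⟩ := exists_arrangement hs hs1 hsa hab hb hκ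
  refine ⟨normalizedSum ν, hA.isProbabilityMeasure, hA.measure_compl_Icc,
    fun x hx => ⟨hA.left_le_locDim x, hA.locDim_le_one hx⟩, hA.volume_locDim_ne_one, ?_,
    fun h hh D hD => hA.dimH_level_le hh fun j hj => hD _ hj⟩
  intro k h hh α β hα hαβ hβ
  obtain ⟨j, rfl, hj⟩ := hdense k α β hα hαβ hβ
  have hsub := hA.level_subset (h' := h) hj
  exact ⟨((hA.piece j).nonempty_level h hh).mono hsub,
    ((hA.piece j).le_dimH_level h hh).trans (dimH_mono hsub)⟩

lemma dimH_of_volume_ne_zero {S : Set ℝ} (h : volume S ≠ 0) : dimH S = 1 := by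
  refine le_antisymm ?_ ?_
  · simpa [Real.dimH_univ] using dimH_mono (subset_univ S)
  · have := le_dimH_of_hausdorffMeasure_ne_zero (d := 1) (s := S)
      (by simpa [hausdorffMeasure_real] using h)
    simpa using this

lemma MemF.exists_steps {f : ℝ → EReal} (hf : MemF f) :
    ∃ a b w : ℕ → ℝ, (∀ n, a n ≤ b n) ∧ (∀ n, b n ≤ 1) ∧ (∃ c, 0 < c ∧ ∀ n, c ≤ a n) ∧
      (∀ n, 0 ≤ w n) ∧ (∀ n, w n ≤ a n) ∧
      ∀ x, f x = ⨆ n, if x ∈ Icc (a n) (b n) then (w n : EReal) else ⊥ := by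
  obtain ⟨I, v, hI, hI01, ⟨c, hc, hcI⟩, hv, hvx, hf⟩ := hf
  choose a b hab hIeq using hI
  have hw : ∀ n, ((v n).toReal : EReal) = v n := fun n => EReal.coe_toReal
    ((hv n).2.trans_lt (EReal.coe_lt_top 1)).ne (EReal.bot_lt_zero.trans_le (hv n).1).ne'
  have ha : ∀ n, a n ∈ I n := fun n => by rw [hIeq]; exact left_mem_Icc.mpr (hab n)
  have hb : ∀ n, b n ∈ I n := fun n => by rw [hIeq]; exact right_mem_Icc.mpr (hab n)
  refine ⟨a, b, fun n => (v n).toReal, hab, fun n => (hI01 n (hb n)).2,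
    ⟨c, hc, fun n => hcI n _ (ha n)⟩, fun n => EReal.toReal_nonneg (hv n).1, fun n => ?_,
    fun x => ?_⟩
  · rw [← EReal.coe_le_coe_iff, hw]
    exact hvx n _ (ha n)
  · simp only [hf x, hw, hIeq]

lemma dimHE_of_nonempty {S : Set ℝ} (h : S.Nonempty) : dimHE S = (dimH S : ℝ≥0∞) := if_pos h

lemma dimHE_locDim_eq_one {μ : Measure ℝ} (hμ : volume {x ∈ Icc (0 : ℝ) 1 | locDim μ x ≠ 1} = 0)
    {B : Set ℝ} (hB : volume B ≠ 0) (hB1 : B ⊆ Icc 0 1) :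
    dimHE {x ∈ B | locDim μ x = 1} = 1 := by
  have h0 : volume {x ∈ B | locDim μ x = 1} ≠ 0 := by
    intro h
    refine hB (measure_mono_null (fun x hx => ?_) (measure_union_null h hμ))
    by_cases h1 : locDim μ x = 1
    · exact Or.inl ⟨hx, h1⟩
    · exact Or.inr ⟨hB1 hx, h1⟩
  rw [dimHE_of_nonempty (nonempty_of_measure_ne_zero h0), dimH_of_volume_ne_zero h0]
  rfl

/-- Prescription of the multifractal spectrum of a homogeneously multifractal measure:
for every `f ∈ 𝓕` there is a HM Borel probability measure `μ` supported in `[0,1]` with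
`d_μ(h) = max (f h) 0` for all `h ∈ Support*(f) \ {1}` (where
`Support*(f) = [sInf Support(f), 1]` is the smallest interval of the form `[h,1]`
containing `Support(f)`), `d_μ(h) = -∞` for `h ∈ [0,∞) \ Support*(f)`, and
`{x ∈ [0,1] : h_μ(x) = 1}` of Lebesgue measure `1`. -/
theorem prescription_HM (f : ℝ → EReal) (hf : MemF f) :
    ∃ μ : Measure ℝ, IsProbabilityMeasure μ ∧ μ (Set.Icc (0:ℝ) 1)ᶜ = 0 ∧ IsHM μ ∧
      (∀ h : ℝ, h ∈ Set.Icc (sInf {x : ℝ | ⊥ < f x}) 1 → h ≠ 1 →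
        spec μ (h : EReal) = max (f h) 0) ∧
      (∀ h : ℝ, 0 ≤ h → h ∉ Set.Icc (sInf {x : ℝ | ⊥ < f x}) 1 →
        spec μ (h : EReal) = ⊥) ∧
      volume {x ∈ Set.Icc (0:ℝ) 1 | locDim μ x = (1 : EReal)} = 1 := by
  obtain ⟨a, b, w, hab, hb, ⟨c, hc, hca⟩, hw, hwa, hf⟩ := hf.exists_steps
  have hS : ∀ x, ⊥ < f x ↔ ∃ n, x ∈ Icc (a n) (b n) := by
    intro x
    rw [hf x, lt_iSup_iff]
    refine exists_congr fun n => ?_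
    by_cases hx : x ∈ Icc (a n) (b n)
    · rw [if_pos hx]
      exact iff_of_true (EReal.bot_lt_coe _) hx
    · rw [if_neg hx]
      exact iff_of_false (lt_irrefl _) hx
  have hlow : c ∈ lowerBounds {x : ℝ | ⊥ < f x} := by
    intro x hx
    obtain ⟨n, hn⟩ := (hS x).mp hx
    exact (hca n).trans hn.1
  have hmem : ∀ n, a n ∈ {x : ℝ | ⊥ < f x} := fun n => (hS _).mpr ⟨n, left_mem_Icc.mpr (hab n)⟩
  set s := sInf {x : ℝ | ⊥ < f x}
  have hs : 0 < s := hc.trans_le (le_csInf ⟨_, hmem 0⟩ hlow)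
  have hsa : ∀ n, s ≤ a n := fun n => csInf_le ⟨c, hlow⟩ (hmem n)
  have hs1 : s ≤ 1 := ((hsa 0).trans (hab 0)).trans (hb 0)
  obtain ⟨μ, hμ, hμ0, hrange, hvol, hlev, hup⟩ := exists_measure_levels
    (ι := Option ({n // 0 < w n} × ℕ)) (s := s)
    (a := fun i => i.elim s fun k => a k.1) (b := fun i => i.elim 1 fun k => b k.1)
    (κ := fun i => i.elim 0 fun k => w k.1 * (1 - 1 / ((k.2 : ℝ) + 1)))
    (v := fun i => i.elim 0 fun k => w k.1) hs hs1
    (by rintro (_ | k); exacts [le_rfl, hsa _]) (by rintro (_ | k); exacts [hs1, hab _])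
    (by rintro (_ | k); exacts [le_rfl, hb _])
    (by
      rintro (_ | ⟨⟨n, hn⟩, m⟩)
      · exact Or.inr ⟨rfl, rfl, rfl⟩
      · have h1 : 1 / ((m : ℝ) + 1) ≤ 1 := (div_le_one (by positivity)).mpr (by simp)
        have h2 : 0 < 1 / ((m : ℝ) + 1) := by positivity
        exact Or.inl ⟨mul_nonneg hn.le (by linarith),
          mul_lt_of_lt_one_right hn (by linarith), hwa n⟩)
  have hlower : ∀ α β : ℝ, 0 ≤ α → α < β → β ≤ 1 → ∀ h ∈ Ico s 1,
      {x ∈ Ioo α β | locDim μ x = h}.Nonempty ∧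
      max (f h) 0 ≤ (dimH {x ∈ Ioo α β | locDim μ x = h} : ℝ≥0∞) := by
    intro α β hα hαβ hβ h hh
    refine ⟨(hlev none h ⟨hh.1, hh.2.le⟩ α β hα hαβ hβ).1,
      max_le ?_ (EReal.coe_ennreal_nonneg _)⟩
    rw [hf h]
    refine iSup_le fun n => ?_
    split_ifs with hn
    swap
    · exact bot_le
    rcases (hw n).eq_or_lt with h0 | h0
    · rw [← h0]
      exact EReal.coe_ennreal_nonneg _
    · have hlim : Tendsto (fun m : ℕ => ENNReal.ofReal (w n * (1 - 1 / ((m : ℝ) + 1)))) atTop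
          (𝓝 (ENNReal.ofReal (w n))) := by
        refine ENNReal.tendsto_ofReal ?_
        simpa using (tendsto_one_div_add_atTop_nhds_zero_nat.const_sub (1 : ℝ)).const_mul (w n)
      have hle := le_of_tendsto' hlim fun m =>
        (hlev (some (⟨n, h0⟩, m)) h hn α β hα hαβ hβ).2
      rw [← max_eq_left h0.le, ← EReal.coe_ennreal_ofReal]
      exact_mod_cast hle
  have hupper : ∀ h ∈ Ico s 1,
      (dimH {x ∈ Icc (0 : ℝ) 1 | locDim μ x = h} : ℝ≥0∞) ≤ max (f h) 0 := by
    intro h hh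
    rw [← EReal.coe_toENNReal (le_max_right (f h) 0), EReal.coe_ennreal_le_coe_ennreal_iff]
    refine hup h hh.2 _ ?_
    rintro (_ | ⟨⟨n, hn⟩, m⟩) hi
    · simp
    · rw [← EReal.coe_ennreal_le_coe_ennreal_iff, EReal.coe_toENNReal (le_max_right _ _),
        EReal.coe_ennreal_ofReal]
      refine le_max_of_le_left ?_
      rw [hf h]
      refine le_iSup_of_le n ?_
      rw [if_pos (show h ∈ Icc (a n) (b n) from hi)]
      exact (congrArg _ (max_eq_left hn.le)).le
  have hmid : ∀ h ∈ Ico s 1, ∀ B ⊆ Icc (0 : ℝ) 1, ∀ α β : ℝ, 0 ≤ α → α < β → β ≤ 1 →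
      Ioo α β ⊆ B → dimHE {x ∈ B | locDim μ x = h} = max (f h) 0 := by
    intro h hh B hB α β hα hαβ hβ hαB
    obtain ⟨hne, hle⟩ := hlower α β hα hαβ hβ h hh
    have hsub : {x ∈ Ioo α β | locDim μ x = h} ⊆ {x ∈ B | locDim μ x = h} :=
      fun x hx => ⟨hαB hx.1, hx.2⟩
    have hsub' : {x ∈ B | locDim μ x = h} ⊆ {x ∈ Icc (0 : ℝ) 1 | locDim μ x = h} :=
      fun x hx => ⟨hB hx.1, hx.2⟩
    rw [dimHE_of_nonempty (hne.mono hsub)]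
    refine le_antisymm (le_trans ?_ (hupper h hh)) (hle.trans ?_)
    · exact_mod_cast dimH_mono hsub'
    · exact_mod_cast dimH_mono hsub
  have hout : ∀ h : EReal, h ∉ Icc (s : EReal) 1 → ∀ B ⊆ Icc (0 : ℝ) 1,
      dimHE {x ∈ B | locDim μ x = h} = ⊥ := by
    intro h hh B hB
    refine if_neg ?_
    rintro ⟨x, hx, rfl⟩
    exact hh (hrange x (hB hx))
  have hone : ∀ B ⊆ Icc (0 : ℝ) 1, ∀ α β : ℝ, α < β → Ioo α β ⊆ B →
      dimHE {x ∈ B | locDim μ x = 1} = 1 := by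
    intro B hB α β hαβ hαB
    refine dimHE_locDim_eq_one hvol (fun h0 => ?_) hB
    have := measure_mono_null hαB h0
    rw [Real.volume_Ioo, ENNReal.ofReal_eq_zero] at this
    linarith
  refine ⟨μ, hμ, hμ0, ?_, ?_, ?_, ?_⟩
  · intro α β hα hαβ hβ h _
    have hB : Ioo α β ⊆ Icc 0 1 := (Ioo_subset_Ioo hα hβ).trans Ioo_subset_Icc_self
    rw [spec]
    by_cases hh : h ∈ Icc (s : EReal) 1
    · rcases hh.2.eq_or_lt with rfl | h1
      · rw [hone _ hB α β hαβ subset_rfl, hone _ subset_rfl 0 1 one_pos Ioo_subset_Icc_self]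
      · lift h to ℝ using
          ⟨(h1.trans (EReal.coe_lt_top 1)).ne, ((EReal.bot_lt_coe s).trans_le hh.1).ne'⟩
        have hI : h ∈ Ico s 1 := ⟨EReal.coe_le_coe_iff.mp hh.1, by exact_mod_cast h1⟩
        rw [hmid h hI _ hB α β hα hαβ hβ subset_rfl,
          hmid h hI _ subset_rfl 0 1 le_rfl one_pos le_rfl Ioo_subset_Icc_self]
    · rw [hout h hh _ hB, hout h hh _ subset_rfl]
  · intro h hh h1
    exact hmid h ⟨hh.1, lt_of_le_of_ne hh.2 h1⟩ _ subset_rfl 0 1 le_rfl one_pos le_rfl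
      Ioo_subset_Icc_self
  · intro h _ hh
    refine hout h (fun hcon => hh ⟨EReal.coe_le_coe_iff.mp hcon.1, ?_⟩) _ subset_rfl
    exact_mod_cast hcon.2
  · refine le_antisymm ?_ ?_
    · simpa using measure_mono (μ := volume)
        (sep_subset (Icc (0 : ℝ) 1) fun x => locDim μ x = 1)
    · have hcov : Icc (0 : ℝ) 1 ⊆ {x ∈ Icc (0 : ℝ) 1 | locDim μ x = 1} ∪
          {x ∈ Icc (0 : ℝ) 1 | locDim μ x ≠ 1} := fun x hx => by
        by_cases h1 : locDim μ x = 1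
        · exact Or.inl ⟨hx, h1⟩
        · exact Or.inr ⟨hx, h1⟩
      have := (measure_mono (μ := volume) hcov).trans (measure_union_le _ _)
      rwa [hvol, add_zero, Real.volume_Icc, sub_zero, ENNReal.ofReal_one] at this
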